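/- arXiv:2310.01091 — 2 statements merged into one kernel-verified Lean document; each statement's English description precedes it below -/
import Mathlib

section
/- Let n ≥ 3, let α₁,…,αₙ be rational integer angles and κ₁,…,κₙ be integers, and set S = (α₁,κ₁,…,α_{n−1},κ_{n−1},αₙ,κₙ). Then there exists a convex polygon with integer vertices whose angle-curvature sequence is S if and only if the following three conditions hold: (1) K(lls(S₁ⁿ)) = 0; (2) κₙ = −⌊K(lls(S₂ⁿ)∘(1)) / K(lls(S₂ⁿ))⌋; (3) the sequence (K(lls(S₁ʲ)))_{j=1}^{n} changes sign exactly n−3 times. -/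
open scoped BigOperators

/-- Integer points of the plane. -/
abbrev Pt := ℤ × ℤ

/-- Determinant of two integer vectors. -/
def vdet (u v : Pt) : ℤ := u.1 * v.2 - u.2 * v.1

/-- Integer length of the segment `PQ`. -/
def il (P Q : Pt) : ℤ := Int.gcd (Q.1 - P.1) (Q.2 - P.2)

/-- Integer distance from the point `P` to the line through `S` and `T`. -/
def idist (P S T : Pt) : ℤ := |vdet (T - S) (P - S)| / il S T

/-- The primitive integer vector in the direction from `P` to `Q`. -/
def primVec (P Q : Pt) : Pt := ((Q.1 - P.1) / il P Q, (Q.2 - P.2) / il P Q)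

/-- `Q` lies on the ray emanating from `V` through `X`. -/
def OnRay (V X Q : Pt) : Prop := ∃ s t : ℤ, 0 < s ∧ 0 < t ∧ s • (Q - V) = t • (X - V)

/-- `P` lies in the convex angle with vertex `V` and edge rays towards `X` and `Y`. -/
def InAngle (X V Y P : Pt) : Prop :=
  ∃ q s t : ℤ, 0 < q ∧ 0 ≤ s ∧ 0 ≤ t ∧ q • (P - V) = s • (X - V) + t • (Y - V)

/-- An affine lattice-preserving transformation of `ℤ²` (an element of Aff(2,ℤ)). -/
structure IntAff where
  a : ℤ
  b : ℤ
  c : ℤ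
  d : ℤ
  u : ℤ
  v : ℤ
  unimod : a * d - b * c = 1 ∨ a * d - b * c = -1

/-- Action of an element of Aff(2,ℤ) on an integer point. -/
def IntAff.apply (T : IntAff) (P : Pt) : Pt :=
  (T.a * P.1 + T.b * P.2 + T.u, T.c * P.1 + T.d * P.2 + T.v)

/-- Integer congruence of the angles ∠XVY and ∠X'V'Y' (vertices `V`, `V'`). -/
def AngleCong (X V Y X' V' Y' : Pt) : Prop :=
  ∃ T : IntAff, T.apply V = V' ∧ OnRay V' X' (T.apply X) ∧ OnRay V' Y' (T.apply Y)

/-- Auxiliary function: continuant of the reversed list. -/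
def contRev : List ℤ → ℤ
  | [] => 1
  | [x] => x
  | x :: y :: l => x * contRev (y :: l) + contRev l

/-- The continuant `K`: `K(ε)=1`, `K(x₁)=x₁`,
`K(x₁,…,xₙ)=xₙK(x₁,…,x_{n−1})+K(x₁,…,x_{n−2})`. -/
def cont (l : List ℤ) : ℤ := contRev l.reverse

/-- A list is a valid LLS sequence of a rational integer angle:
odd length and positive entries. -/
def ValidLLS (l : List ℤ) : Prop := l.length % 2 = 1 ∧ ∀ x ∈ l, 0 < x

/-- The second edge point of the standard angle ∠(a₀,…,a₂ₘ):
the point `(K(a₁,…,a₂ₘ), K(a₀,…,a₂ₘ))`. -/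
def stdPt (l : List ℤ) : Pt := (cont l.tail, cont l)

/-- The angle ∠XVY (vertex `V`) is a rational angle with LLS sequence `l`;
equivalently it is integer congruent to the standard angle
∠((1,0),(0,0),(K(a₁,…,a₂ₘ),K(a₀,…,a₂ₘ))) of the list. -/
def IsLLSOfAngle (X V Y : Pt) (l : List ℤ) : Prop :=
  ValidLLS l ∧ AngleCong ((1, 0) : Pt) ((0, 0) : Pt) (stdPt l) X V Y

open Classical in
/-- Direction comparison sign `sgn⟨u,w⟩`: `1` if `w` has the same direction as `u`,
`0` if `w = 0`, and `-1` otherwise. -/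
noncomputable def sgnDir (u w : Pt) : ℤ :=
  if w = ((0 : ℤ), (0 : ℤ)) then 0
  else if ∃ s t : ℤ, 0 < s ∧ 0 < t ∧ s • w = t • u then 1 else -1

/-- `P` is the integer point of the angle ∠XVY at integer distance 1 from the
line `VY` which is closest to the line `XV`. -/
def IsNearPt (X V Y P : Pt) : Prop :=
  InAngle X V Y P ∧ idist P V Y = 1 ∧
  ∀ Q : Pt, InAngle X V Y Q → idist Q V Y = 1 → idist P X V ≤ idist Q X V

/-- `k` is the chord curvature of the locally convex broken line `ABCD`. -/
def IsChordCurv (A B C D : Pt) (k : ℤ) : Prop :=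
  ∃ B' C' : Pt, IsNearPt A B C B' ∧ IsNearPt D C B C' ∧
    k = il B C - sgnDir (C - B) (C' - B') * il B' C' - 2

/-- `A` lists the vertices of a convex polygon (in convex position, ordered so that
all interior angles are positively oriented). -/
def ConvexPolygon (n : ℕ) (A : ZMod n → Pt) : Prop :=
  ∀ i j : ZMod n, j ≠ i → j ≠ i + 1 → vdet (A (i + 1) - A i) (A j - A i) < 0

/-- A closed broken line (polygon) all of whose angles have the same orientation. -/
def LocallyConvexPolygon (n : ℕ) (A : ZMod n → Pt) : Prop :=
  (∀ i : ZMod n, 0 < vdet (A (i - 1) - A i) (A (i + 1) - A i)) ∨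
  (∀ i : ZMod n, vdet (A (i - 1) - A i) (A (i + 1) - A i) < 0)

/-- A locally convex closed polygon with positively oriented angles. -/
def PosLocConvexPolygon (n : ℕ) (A : ZMod n → Pt) : Prop :=
  ∀ i : ZMod n, 0 < vdet (A (i - 1) - A i) (A (i + 1) - A i)

/-- A locally convex broken line `A 0 … A (n+1)` (angles at vertices `1,…,n`). -/
def LocallyConvexBL (n : ℕ) (A : ℕ → Pt) : Prop :=
  (∀ i, 1 ≤ i → i ≤ n → 0 < vdet (A (i - 1) - A i) (A (i + 1) - A i)) ∨
  (∀ i, 1 ≤ i → i ≤ n → vdet (A (i - 1) - A i) (A (i + 1) - A i) < 0)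

/-- A locally convex broken line with positively oriented angles. -/
def PosLocConvexBL (n : ℕ) (A : ℕ → Pt) : Prop :=
  ∀ i, 1 ≤ i → i ≤ n → 0 < vdet (A (i - 1) - A i) (A (i + 1) - A i)

/-- The polygon `A` (with `n` vertices) has angle-curvature sequence
`(L 0, κ 0, …, L (n-1), κ (n-1))` (0-indexed). -/
def HasACS (n : ℕ) (A : ZMod n → Pt) (L : ℕ → List ℤ) (κ : ℕ → ℤ) : Prop :=
  ∀ i : ℕ, i < n →
    IsLLSOfAngle (A ((i : ZMod n) - 1)) (A (i : ZMod n)) (A ((i : ZMod n) + 1)) (L i) ∧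
    IsChordCurv (A ((i : ZMod n) - 1)) (A (i : ZMod n)) (A ((i : ZMod n) + 1))
      (A ((i : ZMod n) + 2)) (κ i)

/-- `llsCat L κ j m = lls(S_j^{j+m})`, the concatenation
`lls(α_j) ∘ (κ_j) ∘ ⋯ ∘ (κ_{j+m-1}) ∘ lls(α_{j+m})` (0-indexed angles). -/
def llsCat (L : ℕ → List ℤ) (κ : ℕ → ℤ) (j : ℕ) : ℕ → List ℤ
  | 0 => L j
  | m + 1 => llsCat L κ j m ++ (κ (j + m) :: L (j + m + 1))

/-- Number of consecutive opposite-sign pairs. -/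
def altCount : List ℤ → ℕ
  | x :: y :: l => (if x * y < 0 then 1 else 0) + altCount (y :: l)
  | _ => 0

/-- Number of sign changes of an integer sequence: after removing all zero
elements, the number of pairs of consecutive elements with opposite signs. -/
def signChanges (l : List ℤ) : ℕ := altCount (l.filter (fun x => x != 0))

/-- Coercion of an integer point to the real plane. -/
noncomputable def toR (P : Pt) : ℝ × ℝ := ((P.1 : ℝ), (P.2 : ℝ))

/-- The integer points of the angle ∠XVY distinct from the vertex. -/
def conePts (X V Y : Pt) : Set Pt := {P | InAngle X V Y P ∧ P ≠ V}

/-- `P` is a vertex of the sail of the angle ∠XVY: an integer point of the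
angle (other than the vertex) which is a vertex of the convex hull of all
such points. -/
def SailVertex (X V Y P : Pt) : Prop :=
  P ∈ conePts X V Y ∧ toR P ∉ convexHull ℝ (toR '' (conePts X V Y \ {P}))

/-- `B 0, …, B m` is the broken line formed by the vertices of the sail of the
angle ∠XVY, ordered from the edge `VX` to the edge `VY`. -/
def IsSailBL (X V Y : Pt) (m : ℕ) (B : ℕ → Pt) : Prop :=
  (∀ i ≤ m, SailVertex X V Y (B i)) ∧
  (∀ P, SailVertex X V Y P → ∃ i ≤ m, B i = P) ∧
  (∀ i ≤ m, ∀ j ≤ m, B i = B j → i = j) ∧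
  OnRay V X (B 0) ∧ OnRay V Y (B m) ∧
  (∀ i < m, vdet (B (i + 1) - B i) (V - B i) ≠ 0 ∧
    ∀ P, SailVertex X V Y P →
      vdet (B (i + 1) - B i) (V - B i) * vdet (B (i + 1) - B i) (P - B i) ≤ 0)

/-- Sign alternation used in sail diagrams (`1` on the first angle). -/
def sgnAlt (i : ℕ) : ℤ := if i % 2 = 0 then 1 else -1

/-- `D` is the sail diagram of the polygon `A` with the decomposition data
`m` (numbers of sail edges), `c` (offsets) and `B` (sails of the angles):
the concatenation of the sails of the consecutive angles translated to the
origin, composed with the central symmetry for alternate angles. -/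
def IsSailDiagramAux (n : ℕ) (A : ZMod n → Pt) (m c : ℕ → ℕ) (B : ℕ → ℕ → Pt)
    (D : ℕ → Pt) : Prop :=
  c 0 = 0 ∧ (∀ i, c (i + 1) = c i + m i) ∧
  ∀ i < n,
    IsSailBL (A ((i : ZMod n) - 1)) (A (i : ZMod n)) (A ((i : ZMod n) + 1)) (m i) (B i) ∧
    ∀ j ≤ m i, D (c i + j) = sgnAlt i • (B i j - A (i : ZMod n))

/-- `D 0 … D M` is the sail diagram of the polygon `A`. -/
def IsSailDiagram (n : ℕ) (A : ZMod n → Pt) (M : ℕ) (D : ℕ → Pt) : Prop :=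
  ∃ m c B, IsSailDiagramAux n A m c B D ∧ M = c n

/-- `D 0 … D M` is the sail diagram of the broken line `A 0 … A (n+1)`
(whose angles are at the vertices `1,…,n`). -/
def IsSailDiagramBL (n : ℕ) (A : ℕ → Pt) (M : ℕ) (D : ℕ → Pt) : Prop :=
  ∃ (m c : ℕ → ℕ) (B : ℕ → ℕ → Pt),
    c 1 = 0 ∧ (∀ i, c (i + 1) = c i + m i) ∧ M = c (n + 1) ∧
    ∀ i, 1 ≤ i → i ≤ n →
      IsSailBL (A (i - 1)) (A i) (A (i + 1)) (m i) (B i) ∧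
      ∀ j ≤ m i, D (c i + j) = sgnAlt (i + 1) • (B i j - A i)

/-- Euclidean angular measure of the angle between the vectors `u` and `v`. -/
noncomputable def angMeasure (u v : Pt) : ℝ :=
  Real.arccos (((u.1 * v.1 + u.2 * v.2 : ℤ) : ℝ) /
    (Real.sqrt ((u.1 : ℝ) ^ 2 + (u.2 : ℝ) ^ 2) * Real.sqrt ((v.1 : ℝ) ^ 2 + (v.2 : ℝ) ^ 2)))

/-- Winding number of the broken line `D 0 … D M` about the origin. -/
noncomputable def winding (M : ℕ) (D : ℕ → Pt) : ℝ :=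
  (∑ i ∈ Finset.range M, angMeasure (D i) (D (i + 1))) / (2 * Real.pi)

/-- The segment `(b st, b (st+1), …, b (st+len-1))` of a sequence as a list. -/
def bseg (b : ℕ → ℤ) (st len : ℕ) : List ℤ := (List.range len).map fun t => b (st + t)

/-- The edge vertex `Bᵢ` of a normalized sail diagram, via continuants:
`(K(b₁,…,b_{2s}), K(b₀,…,b_{2s}))` where `s = s(i)`. -/
def BiPt (b : ℕ → ℤ) (s : ℕ) : Pt := (cont (bseg b 1 (2 * s)), cont (bseg b 0 (2 * s + 1)))

/-- The integer point `Bᵢ⁺` following `Bᵢ`: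
`(K(b₁,…,b_{2s},b_{2s+1},1), K(b₀,…,b_{2s},b_{2s+1},1))`. -/
def BpPt (b : ℕ → ℤ) (s : ℕ) : Pt :=
  (cont (bseg b 1 (2 * s) ++ [b (2 * s + 1), 1]),
   cont (bseg b 0 (2 * s + 1) ++ [b (2 * s + 1), 1]))

/-- The integer point `Bᵢ⁻` preceding `Bᵢ`:
`(K(b₁,…,b_{2s}−1), K(b₀,…,b_{2s}−1))`. -/
def BmPt (b : ℕ → ℤ) (s : ℕ) : Pt :=
  (cont (bseg b 1 (2 * s - 1) ++ [b (2 * s) - 1]),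
   cont (bseg b 0 (2 * s) ++ [b (2 * s) - 1]))

/-- The point `B̂ᵢ = (K(b₁,…,b_{2s},0,1), K(b₀,…,b_{2s},0,1))`. -/
def hatBPt (b : ℕ → ℤ) (s : ℕ) : Pt :=
  (cont (bseg b 1 (2 * s) ++ [0, 1]), cont (bseg b 0 (2 * s + 1) ++ [0, 1]))


/-! ### Algebra of frames -/

def vstep (p : Pt × Pt) (x : ℤ) : Pt × Pt := (p.2, p.1 + x • p.2)

def vfold (l : List ℤ) (p : Pt × Pt) : Pt × Pt := l.foldl vstep p

def stdI : Pt × Pt := ((1, 0), (0, 1))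

lemma vfold_append (l l' : List ℤ) (p : Pt × Pt) :
    vfold (l ++ l') p = vfold l' (vfold l p) := by
  simp [vfold, List.foldl_append]

lemma vfold_cons (x : ℤ) (l : List ℤ) (p : Pt × Pt) :
    vfold (x :: l) p = vfold l (vstep p x) := rfl

lemma vfold_nil (p : Pt × Pt) : vfold [] p = p := rfl

lemma vfold_map (φ : Pt →+ Pt) (l : List ℤ) (p : Pt × Pt) :
    vfold l (φ p.1, φ p.2) = (φ (vfold l p).1, φ (vfold l p).2) := by
  induction l generalizing p with
  | nil => rfl
  | cons x l ih =>
    rw [vfold_cons, vfold_cons, ← ih]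
    simp only [vstep, map_add, map_zsmul]

/-- the additive map with columns `u`, `h` -/
def colMap (u h : Pt) : Pt →+ Pt where
  toFun P := P.1 • u + P.2 • h
  map_zero' := by simp
  map_add' := by
    intro P Q
    simp only [Prod.fst_add, Prod.snd_add, add_smul]
    abel

lemma colMap_apply (u h P : Pt) : colMap u h P = P.1 • u + P.2 • h := rfl

lemma vfold_eq (l : List ℤ) (p : Pt × Pt) :
    vfold l p = (colMap p.1 p.2 (vfold l stdI).1, colMap p.1 p.2 (vfold l stdI).2) := by
  rw [← vfold_map]
  congr 1
  simp [stdI, colMap_apply]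

lemma vfold_neg (l : List ℤ) (p : Pt × Pt) : vfold l (-p) = -(vfold l p) := by
  have := vfold_map (-(AddMonoidHom.id Pt)) l p
  exact this

lemma vdet_colMap (u h P Q : Pt) : vdet (colMap u h P) (colMap u h Q) = vdet u h * vdet P Q := by
  simp [colMap_apply, vdet]; ring

lemma vdet_vstep (p : Pt × Pt) (x : ℤ) : vdet (vstep p x).1 (vstep p x).2 = - vdet p.1 p.2 := by
  simp [vstep, vdet]; ring

lemma vdet_vfold (l : List ℤ) (p : Pt × Pt) :
    vdet (vfold l p).1 (vfold l p).2 = (-1) ^ l.length * vdet p.1 p.2 := by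
  induction l generalizing p with
  | nil => simp [vfold]
  | cons x l ih => rw [vfold_cons, ih, vdet_vstep, List.length_cons, pow_succ]; ring

lemma cont_append (l : List ℤ) (x y : ℤ) :
    cont (l ++ [x, y]) = y * cont (l ++ [x]) + cont l := by
  simp [cont, contRev]

lemma vfold_concat (l : List ℤ) (x : ℤ) (p : Pt × Pt) :
    vfold (l ++ [x]) p = vstep (vfold l p) x := by
  rw [vfold_append]; rfl

lemma vfold_aux (l : List ℤ) : (vfold l stdI).2.2 = cont l ∧
    ∀ x, (vfold (l ++ [x]) stdI).2.2 = cont (l ++ [x]) := by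
  induction l using List.reverseRecOn with
  | nil => simp [vfold, stdI, vstep, cont, contRev]
  | append_singleton l y ih =>
    refine ⟨ih.2 y, fun x => ?_⟩
    rw [List.append_assoc, List.singleton_append, cont_append, ← ih.2 y, ← ih.1]
    have : l ++ [y, x] = (l ++ [y]) ++ [x] := by simp
    rw [this, vfold_concat, vfold_concat]
    simp [vstep]; ring

lemma vfold_snd (l : List ℤ) : (vfold l stdI).2.2 = cont l := (vfold_aux l).1

def swapMap : Pt →+ Pt where
  toFun P := (P.2, P.1)
  map_zero' := rfl
  map_add' := fun _ _ => rfl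

lemma vfold_std (l : List ℤ) (hl : l ≠ []) : (vfold l stdI).2 = stdPt l := by
  cases l with
  | nil => exact absurd rfl hl
  | cons x l =>
    refine Prod.ext ?_ (vfold_snd _)
    simp only [stdPt, List.tail_cons]
    rw [← vfold_snd, vfold_cons]
    have h1 := vfold_eq l (vstep stdI x)
    rw [h1]
    simp [vstep, stdI, colMap_apply]

lemma valid_ne {l : List ℤ} (h : ValidLLS l) : l ≠ [] := by
  rintro rfl; simp [ValidLLS] at h

lemma valid_pos_aux (l : List ℤ) (p : Pt × Pt) (hl : ∀ x ∈ l, 0 < x)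
    (h : 0 ≤ p.1.1 ∧ 0 < p.2.1 ∧ 0 < p.1.2 ∧ p.1.2 ≤ p.2.2 ∧ p.2.1 ≤ p.2.2 ∧ p.1.1 ≤ p.1.2) :
    0 ≤ (vfold l p).1.1 ∧ 0 < (vfold l p).2.1 ∧ 0 < (vfold l p).1.2 ∧
      (vfold l p).1.2 ≤ (vfold l p).2.2 ∧ (vfold l p).2.1 ≤ (vfold l p).2.2 ∧
      (vfold l p).1.1 ≤ (vfold l p).1.2 := by
  induction l generalizing p with
  | nil => exact h
  | cons x l ih =>
    rw [vfold_cons]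
    apply ih
    · intro y hy; exact hl y (List.mem_cons_of_mem _ hy)
    · have hx : 0 < x := hl x (by simp)
      obtain ⟨h1, h2, h3, h4, h5, h6⟩ := h
      simp only [vstep, Prod.fst_add, Prod.snd_add, Prod.smul_fst, Prod.smul_snd, smul_eq_mul]
      refine ⟨h2.le, by nlinarith, by nlinarith, by nlinarith, by nlinarith, h5⟩

/-- numeric facts on a valid LLS sequence -/
lemma valid_facts {l : List ℤ} (h : ValidLLS l) :
    0 < (stdPt l).1 ∧ (stdPt l).1 ≤ (stdPt l).2 ∧ 0 < (vfold l stdI).1.2 ∧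
    (vfold l stdI).1.2 ≤ (stdPt l).2 ∧ vdet (vfold l stdI).1 (stdPt l) = -1 := by
  rw [← vfold_std l (valid_ne h)]
  have hd := vdet_vfold l stdI
  obtain ⟨hlen, hpos⟩ := h
  rw [Odd.neg_one_pow (Nat.odd_iff.mpr hlen)] at hd
  cases l with
  | nil => simp at hlen
  | cons x l =>
    have := valid_pos_aux l (vstep stdI x) (fun y hy => hpos y (List.mem_cons_of_mem _ hy))
      (by have : 0 < x := hpos x (by simp)
          simp [vstep, stdI]; omega)
    rw [vfold_cons] at hd ⊢
    refine ⟨this.2.1, this.2.2.2.2.1, this.2.2.1, this.2.2.2.1, ?_⟩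
    rw [hd]; simp [stdI, vdet]

/-- frames in standard coordinates -/
def Fr (L : ℕ → List ℤ) (κ : ℕ → ℤ) : ℕ → Pt × Pt
  | 0 => stdI
  | j + 1 => -(vstep (vfold (L j) (Fr L κ j)) (κ j))

/-- edge directions -/
def zt (L : ℕ → List ℤ) (κ : ℕ → ℤ) (j : ℕ) : Pt := -(Fr L κ j).1

lemma zt_zero (L : ℕ → List ℤ) (κ : ℕ → ℤ) : zt L κ 0 = (-1, 0) := by
  simp [zt, Fr, stdI]

lemma zt_succ (L : ℕ → List ℤ) (κ : ℕ → ℤ) (j : ℕ) :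
    zt L κ (j + 1) = (vfold (L j) (Fr L κ j)).2 := by
  simp [zt, Fr, vstep]

lemma Fr_det (L : ℕ → List ℤ) (κ : ℕ → ℤ) (j : ℕ) (hL : ∀ i < j, ValidLLS (L i)) :
    vdet (Fr L κ j).1 (Fr L κ j).2 = 1 := by
  induction j with
  | zero => simp [Fr, stdI, vdet]
  | succ j ih =>
    have h1 := ih (fun i hi => hL i (by omega))
    have h2 := vdet_vfold (L j) (Fr L κ j)
    have h3 := vdet_vstep (vfold (L j) (Fr L κ j)) (κ j)
    rw [Odd.neg_one_pow (Nat.odd_iff.mpr (hL j (by omega)).1), h1] at h2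
    rw [h2] at h3
    simp only [Fr]
    have : ∀ p : Pt × Pt, vdet (-p).1 (-p).2 = vdet p.1 p.2 := by
      intro p; simp [vdet]
    rw [this, h3]; norm_num

lemma zt_succ' (L : ℕ → List ℤ) (κ : ℕ → ℤ) (j : ℕ) (h : ValidLLS (L j)) :
    zt L κ (j + 1) = colMap (Fr L κ j).1 (Fr L κ j).2 (stdPt (L j)) := by
  rw [zt_succ, vfold_eq, vfold_std _ (valid_ne h)]

lemma zt_det (L : ℕ → List ℤ) (κ : ℕ → ℤ) (j : ℕ) (hL : ∀ i < j + 1, ValidLLS (L i)) :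
    vdet (zt L κ j) (zt L κ (j + 1)) < 0 := by
  have h1 := Fr_det L κ j (fun i hi => hL i (by omega))
  have h2 := valid_facts (hL j (by omega))
  rw [zt_succ' _ _ _ (hL j (by omega)), zt]
  have : vdet (-(Fr L κ j).1) (colMap (Fr L κ j).1 (Fr L κ j).2 (stdPt (L j)))
      = - (vdet (Fr L κ j).1 (Fr L κ j).2 * (stdPt (L j)).2) := by
    simp [vdet, colMap_apply]; ring
  rw [this, h1]; linarith

lemma vfold_llsCat (L : ℕ → List ℤ) (κ : ℕ → ℤ) (j : ℕ) :
    vfold (llsCat L κ 0 j) stdI = ((-1 : ℤ) ^ j) • vfold (L j) (Fr L κ j) := by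
  induction j with
  | zero => simp [llsCat, Fr]
  | succ j ih =>
    have hs : ∀ (c : ℤ) (l : List ℤ) (p : Pt × Pt), vfold l (c • p) = c • vfold l p := by
      intro c l p
      have := vfold_map (c • (AddMonoidHom.id Pt)) l p
      exact this
    have h2 : ∀ (c : ℤ) (p : Pt × Pt) x, vstep (c • p) x = c • vstep p x := by
      intro c p x; simp [vstep, Prod.ext_iff]; constructor <;> ring
    rw [llsCat, vfold_append, vfold_cons, ih, zero_add, h2, hs]
    simp only [Fr]
    rw [vfold_neg, pow_succ]
    simp

lemma cont_llsCat (L : ℕ → List ℤ) (κ : ℕ → ℤ) (j : ℕ) :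
    cont (llsCat L κ 0 j) = (-1) ^ j * (zt L κ (j + 1)).2 := by
  rw [← vfold_snd, vfold_llsCat, zt_succ]; simp

lemma llsCat_split (L : ℕ → List ℤ) (κ : ℕ → ℤ) (j m : ℕ) :
    llsCat L κ j (m + 1) = L j ++ (κ j :: llsCat L κ (j + 1) m) := by
  induction m with
  | zero => simp [llsCat]
  | succ m ih =>
    rw [llsCat, ih]
    conv_rhs => rw [llsCat]
    have e1 : j + (m + 1) = j + 1 + m := by ring
    simp [e1]

/-- condition (2) -/
lemma floor_cond (L : ℕ → List ℤ) (κ : ℕ → ℤ) (m : ℕ) (hL : ∀ i < m + 2, ValidLLS (L i))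
    (hz : zt L κ (m + 2) = (-1, 0)) :
    κ (m + 1) = -⌊(cont (llsCat L κ 1 m ++ [1]) : ℚ) / (cont (llsCat L κ 1 m) : ℚ)⌋ ↔
      Fr L κ (m + 2) = stdI := by
  have hc1 : cont (llsCat L κ 1 m ++ [1]) =
      (vfold (llsCat L κ 1 m) stdI).1.2 + (vfold (llsCat L κ 1 m) stdI).2.2 := by
    rw [← vfold_snd, vfold_concat]; simp [vstep]
  rw [hc1, ← vfold_snd]
  have hV := vfold_llsCat L κ (m + 1)
  rw [llsCat_split, vfold_append, vfold_cons, vfold_eq (llsCat L κ (0 + 1) m), zero_add] at hV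
  have hP : (vstep (vfold (L 0) stdI) (κ 0)).1 = stdPt (L 0) :=
    vfold_std _ (valid_ne (hL 0 (by omega)))
  have hPR : vdet (vstep (vfold (L 0) stdI) (κ 0)).1 (vstep (vfold (L 0) stdI) (κ 0)).2 = 1 := by
    rw [vdet_vstep, vdet_vfold, Odd.neg_one_pow (Nat.odd_iff.mpr (hL 0 (by omega)).1)]
    simp [stdI, vdet]
  have hF := Fr_det L κ (m + 2) hL
  have hf := valid_facts (hL 0 (by omega))
  have hs : (-1 : ℤ) ^ (m + 1) * (-1) ^ (m + 1) = 1 := by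
    rw [← mul_pow]; simp
  have hzz : (Fr L κ (m + 2)).1 = (1, 0) := by
    have : (Fr L κ (m + 2)).1 = - zt L κ (m + 2) := by simp [zt]
    rw [this, hz]; simp
  have hFr : Fr L κ (m + 2) = -(vstep (vfold (L (m + 1)) (Fr L κ (m + 1))) (κ (m + 1))) := rfl
  rw [hP] at hV hPR
  generalize (-1 : ℤ) ^ (m + 1) = s at *
  generalize (vstep (vfold (L 0) stdI) (κ 0)).2 = R at *
  generalize vfold (llsCat L κ 1 m) stdI = M at *
  generalize vfold (L (m + 1)) (Fr L κ (m + 1)) = N at *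
  generalize Fr L κ (m + 2) = F at *
  generalize κ (m + 1) = k at *
  generalize stdPt (L 0) = P at *
  obtain ⟨⟨F1, F2⟩, t, F4⟩ := F
  obtain ⟨⟨N1, N2⟩, N3, N4⟩ := N
  obtain ⟨⟨M1, M2⟩, M3, M4⟩ := M
  obtain ⟨b, a⟩ := P
  obtain ⟨R1, R2⟩ := R
  simp only [vdet, colMap_apply, vstep, stdI, Prod.mk.injEq, Prod.smul_mk, Prod.neg_mk,
    Prod.mk_add_mk, smul_eq_mul] at *
  obtain ⟨⟨e1, e2⟩, e3, e4⟩ := hV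
  obtain ⟨rfl, rfl⟩ := hzz
  obtain ⟨⟨f1, f2⟩, f3, f4⟩ := hFr
  have hF4 : F4 = 1 := by linarith
  subst hF4
  have ha : 0 < a := by omega
  have hK : M4 = s * a := by
    have : M4 = b * (M3 * a + M4 * R2) - a * (M3 * b + M4 * R1) := by
      linear_combination (-M4) * hPR
    rw [this, e3, e4]
    have h3 : N3 = -1 := by linarith
    have h4 : N4 = 0 := by linarith
    rw [h3, h4]; ring
  have hK' : M2 = -(s * (b - a * t)) - k * (s * a) := by
    have : M2 = b * (M1 * a + M2 * R2) - a * (M1 * b + M2 * R1) := by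
      linear_combination (-M2) * hPR
    rw [this, e1, e2]
    have h3 : N3 = -1 := by linarith
    have h4 : N4 = 0 := by linarith
    have h1 : N1 = k - t := by rw [h3] at f3; linarith
    have h2 : N2 = -1 := by rw [h4] at f4; linarith
    rw [h1, h2]; ring
  have hs0 : (s : ℚ) ≠ 0 := by
    intro h
    have : s = 0 := by exact_mod_cast h
    rw [this] at hs; simp at hs
  have ha0 : (a : ℚ) ≠ 0 := by exact_mod_cast ha.ne'
  have hq : (((M2 + M4 : ℤ) : ℚ) / (M4 : ℚ)) = (1 - (b : ℚ) / a) + ((t - k : ℤ) : ℚ) := by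
    rw [hK', hK]; push_cast; field_simp; ring
  rw [hq, Int.floor_add_intCast]
  have hfl : ⌊1 - (b : ℚ) / a⌋ = 0 := by
    rw [Int.floor_eq_zero_iff]
    have ha1 : (0 : ℚ) < a := by exact_mod_cast ha
    have hb1 : (0 : ℚ) < b := by exact_mod_cast hf.1
    have hb2 : (b : ℚ) ≤ a := by exact_mod_cast hf.2.1
    constructor
    · have := (div_le_one ha1).mpr hb2; linarith
    · have := div_pos hb1 ha1; linarith
  rw [hfl]
  constructor
  · intro h; simp; omega
  · intro h; simp at h; omega

/-! ### Geometry of one angle -/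

lemma prim_ray {w x X : Pt} {s t : ℤ} (hw : vdet w x = 1 ∨ vdet w x = -1) (hs : 0 < s)
    (ht : 0 < t) (h : s • w = t • X) : ∃ p : ℤ, 0 < p ∧ X = p • w := by
  have h1 : s * w.1 = t * X.1 := by simpa using congrArg Prod.fst h
  have h2 : s * w.2 = t * X.2 := by simpa using congrArg Prod.snd h
  have key : ∃ p, s = t * p := by
    simp only [vdet] at hw
    rcases hw with hw | hw
    · exact ⟨vdet X x, by simp only [vdet]; linear_combination (-s) * hw + x.2 * h1 - x.1 * h2⟩
    · exact ⟨-vdet X x, by simp only [vdet]; linear_combination (s) * hw - x.2 * h1 + x.1 * h2⟩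
  obtain ⟨p, hp⟩ := key
  have hp0 : 0 < p := by
    rw [hp] at hs; exact (pos_iff_pos_of_mul_pos hs).mp ht
  refine ⟨p, hp0, ?_⟩
  ext
  · have : t * X.1 = t * (p * w.1) := by rw [← h1, hp]; ring
    simpa using mul_left_cancel₀ ht.ne' this
  · have : t * X.2 = t * (p * w.2) := by rw [← h2, hp]; ring
    simpa using mul_left_cancel₀ ht.ne' this

lemma prim_unique {w w' x x' : Pt} {s t : ℤ} (hw : vdet w x = 1 ∨ vdet w x = -1)
    (hw' : vdet w' x' = 1 ∨ vdet w' x' = -1) (hs : 0 < s)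
    (ht : 0 < t) (h : s • w = t • w') : w = w' := by
  obtain ⟨p, hp, e⟩ := prim_ray hw hs ht h
  obtain ⟨q, hq, e'⟩ := prim_ray hw' ht hs h.symm
  have : vdet w' x' = p * q * vdet w' x' := by
    conv_lhs => rw [e, e']
    simp [vdet]; ring
  have hpq : p * q = 1 := by
    rcases hw' with hw' | hw' <;> rw [hw'] at this <;> linarith
  have : p = 1 := by nlinarith
  rw [e, this, one_smul]

lemma vdet_frame {u h : Pt} {l : List ℤ} (hl : ValidLLS l) (hd : vdet u h = 1) :
    vdet (colMap u h (vfold l stdI).1) (colMap u h (stdPt l)) = -1 := by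
  rw [vdet_colMap, hd, (valid_facts hl).2.2.2.2]; norm_num

lemma lls_frame {X V Y : Pt} {l : List ℤ} (h : IsLLSOfAngle X V Y l)
    (hdet : 0 < vdet (X - V) (Y - V)) :
    ∃ (u h : Pt) (p q : ℤ), vdet u h = 1 ∧ 0 < p ∧ 0 < q ∧ X - V = p • u ∧
      Y - V = q • colMap u h (stdPt l) := by
  obtain ⟨hl, T, hV, ⟨s, t, hs, ht, e⟩, ⟨s', t', hs', ht', e'⟩⟩ := h
  obtain ⟨a, b, c, d, u, v, hu⟩ := T
  have hf := valid_facts hl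
  simp only [IntAff.apply] at hV e e'
  subst hV
  have e1 : s • ((a, c) : Pt) = t • (X - (a * 0 + b * 0 + u, c * 0 + d * 0 + v)) := by
    rw [← e]; congr 1; ext <;> simp
  have e1' : s' • (colMap (a, c) (b, d) (stdPt l)) =
      t' • (Y - (a * 0 + b * 0 + u, c * 0 + d * 0 + v)) := by
    rw [← e']; congr 1; simp only [colMap_apply]; ext <;> simp <;> ring
  have hu' : vdet (a, c) (b, d) = 1 ∨ vdet (a, c) (b, d) = -1 := by
    simp only [vdet]
    rcases hu with hu | hu
    · left; linarith
    · right; linarith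
  obtain ⟨p, hp, ep⟩ := prim_ray hu' hs ht e1
  have hw : vdet (colMap (a, c) (b, d) (stdPt l)) (colMap (a, c) (b, d) (vfold l stdI).1) = 1 ∨
      vdet (colMap (a, c) (b, d) (stdPt l)) (colMap (a, c) (b, d) (vfold l stdI).1) = -1 := by
    rw [vdet_colMap]
    have : vdet (stdPt l) (vfold l stdI).1 = 1 := by
      have h5 := hf.2.2.2.2
      simp only [vdet] at h5 ⊢; linarith
    rw [this, mul_one]; exact hu'
  obtain ⟨q, hq, eq⟩ := prim_ray hw hs' ht' e1'
  refine ⟨(a, c), (b, d), p, q, ?_, hp, hq, ep, eq⟩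
  rw [ep, eq] at hdet
  have : vdet (p • ((a, c) : Pt)) (q • colMap (a, c) (b, d) (stdPt l)) =
      (p * q * (stdPt l).2) * vdet (a, c) (b, d) := by
    simp [vdet, colMap_apply]; ring
  rw [this] at hdet
  have h6 : 0 < p * q * (stdPt l).2 := by
    have : 0 < (stdPt l).2 := by omega
    positivity
  rcases hu' with h7 | h7
  · exact h7
  · rw [h7] at hdet; linarith

lemma frame_lls {X V Y u h : Pt} {l : List ℤ} {p q : ℤ} (hl : ValidLLS l)
    (hd : vdet u h = 1) (hp : 0 < p) (hq : 0 < q) (hX : X - V = p • u)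
    (hY : Y - V = q • colMap u h (stdPt l)) : IsLLSOfAngle X V Y l := by
  refine ⟨hl, ⟨u.1, h.1, u.2, h.2, V.1, V.2, ?_⟩, ?_, ?_, ?_⟩
  · left; simp only [vdet] at hd; linarith
  · simp [IntAff.apply]
  · refine ⟨p, 1, hp, one_pos, ?_⟩
    rw [hX]; ext <;> simp [IntAff.apply]
  · refine ⟨q, 1, hq, one_pos, ?_⟩
    rw [hY]; simp only [colMap_apply, IntAff.apply]; ext <;> simp <;> ring

lemma gcd_prim {w x : Pt} (hw : vdet w x = 1 ∨ vdet w x = -1) (c : ℤ) :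
    ((Int.gcd (c * w.1) (c * w.2) : ℕ) : ℤ) = |c| := by
  have h1 : Int.gcd w.1 w.2 = 1 := by
    rw [← Int.isCoprime_iff_gcd_eq_one]
    simp only [vdet] at hw
    rcases hw with hw | hw
    · exact ⟨x.2, -x.1, by linarith⟩
    · exact ⟨-x.2, x.1, by linarith⟩
  rw [Int.gcd_mul_left, h1, mul_one, Int.natCast_natAbs]

lemma il_prim {P Q w x : Pt} (hw : vdet w x = 1 ∨ vdet w x = -1) {c : ℤ}
    (h : Q - P = c • w) : il P Q = |c| := by
  rw [← gcd_prim hw c, il]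
  have h1 : Q.1 - P.1 = c * w.1 := by simpa using congrArg Prod.fst h
  have h2 : Q.2 - P.2 = c * w.2 := by simpa using congrArg Prod.snd h
  rw [h1, h2]

lemma idist_prim {P S T w x : Pt} (hw : vdet w x = 1 ∨ vdet w x = -1) {c : ℤ} (hc : c ≠ 0)
    (h : T - S = c • w) : idist P S T = |vdet w (P - S)| := by
  rw [idist, il_prim hw h, h]
  have : vdet (c • w) (P - S) = c * vdet w (P - S) := by simp [vdet]; ring
  rw [this, abs_mul]
  exact Int.mul_ediv_cancel_left _ (abs_ne_zero.mpr hc)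

/-- near points, in terms of orientation `σ = ±1`. -/
lemma near_iff {X V Y x x' y y' v : Pt} {p q σ : ℤ} (hσ : σ = 1 ∨ σ = -1)
    (hx : vdet x x' = 1 ∨ vdet x x' = -1) (hy : vdet y y' = 1 ∨ vdet y y' = -1)
    (hp : 0 < p) (hq : 0 < q) (hX : X - V = p • x) (hY : Y - V = q • y)
    (h1 : σ * vdet v y = 1) (h2 : 0 ≤ σ * vdet x v) (h3 : σ * vdet x v < σ * vdet x y) (P : Pt) :
    IsNearPt X V Y P ↔ P = V + v := by
  have hin : ∀ Q : Pt, InAngle X V Y Q ↔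
      (0 ≤ σ * vdet x (Q - V) ∧ 0 ≤ σ * vdet (Q - V) y) := by
    intro Q
    have hD : 0 < σ * vdet x y := by linarith
    constructor
    · rintro ⟨k, s, t, hk, hs, ht, e⟩
      rw [hX, hY] at e
      have a1 : k * (σ * vdet x (Q - V)) = (t * q) * (σ * vdet x y) := by
        have : vdet x (k • (Q - V)) = vdet x (s • p • x + t • q • y) := by rw [e]
        have e1 : vdet x (k • (Q - V)) = k * vdet x (Q - V) := by simp [vdet]; ring
        have e2 : vdet x (s • p • x + t • q • y) = t * q * vdet x y := by simp [vdet]; ring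
        rw [e1, e2] at this
        linear_combination σ * this
      have a2 : k * (σ * vdet (Q - V) y) = (s * p) * (σ * vdet x y) := by
        have : vdet (k • (Q - V)) y = vdet (s • p • x + t • q • y) y := by rw [e]
        have e1 : vdet (k • (Q - V)) y = k * vdet (Q - V) y := by simp [vdet]; ring
        have e2 : vdet (s • p • x + t • q • y) y = s * p * vdet x y := by simp [vdet]; ring
        rw [e1, e2] at this
        linear_combination σ * this
      constructor
      · have : 0 ≤ k * (σ * vdet x (Q - V)) := by rw [a1]; positivity
        exact nonneg_of_mul_nonneg_right this hk
      · have : 0 ≤ k * (σ * vdet (Q - V) y) := by rw [a2]; positivity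
        exact nonneg_of_mul_nonneg_right this hk
    · rintro ⟨a1, a2⟩
      refine ⟨p * q * (σ * vdet x y), q * (σ * vdet (Q - V) y), p * (σ * vdet x (Q - V)),
        by positivity, by positivity, by positivity, ?_⟩
      rw [hX, hY]
      ext <;> simp [vdet] <;> ring
  have hd1 : ∀ Q : Pt, idist Q V Y = |vdet y (Q - V)| := fun Q => idist_prim hy hq.ne' hY
  have hd2 : ∀ Q : Pt, idist Q X V = |vdet x (Q - V)| := by
    intro Q
    have hX' : V - X = (-p) • x := by rw [neg_smul, ← hX]; abel
    rw [idist_prim hx (by omega) hX']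
    congr 1
    have : Q - X = (Q - V) - p • x := by rw [← hX]; abel
    rw [this]; simp [vdet]; ring
  have hsw : ∀ Q : Pt, vdet y Q = - vdet Q y := by intro Q; simp [vdet]; ring
  have habs : ∀ z : ℤ, 0 ≤ σ * z → |z| = σ * z := by
    intro z hz
    rcases hσ with rfl | rfl
    · rw [one_mul] at *; exact abs_of_nonneg hz
    · rw [neg_one_mul] at *; exact abs_of_nonpos (by linarith)
  have hv : InAngle X V Y (V + v) ∧ idist (V + v) V Y = 1 := by
    rw [hin, hd1, hsw, abs_neg, add_sub_cancel_left]
    exact ⟨⟨h2, by linarith⟩, by rw [habs _ (by linarith), h1]⟩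
  have hcmp : ∀ Q : Pt, InAngle X V Y Q → idist Q V Y = 1 →
      ∃ k : ℤ, 0 ≤ k ∧ Q = V + v + k • y := by
    intro Q hQ hQ1
    rw [hin] at hQ
    rw [hd1, hsw, abs_neg, habs _ hQ.2] at hQ1
    have hpar : vdet (Q - V - v) y = 0 := by
      have : vdet (Q - V - v) y = vdet (Q - V) y - vdet v y := by simp [vdet]; ring
      rw [this]
      rcases hσ with rfl | rfl <;> linarith
    have hk : ∃ k : ℤ, Q - V - v = k • y := by
      simp only [vdet] at hpar hy
      rcases hy with hy | hy
      · refine ⟨vdet (Q - V - v) y', ?_⟩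
        simp only [vdet]
        ext
        · simp only [Prod.smul_fst, smul_eq_mul]
          linear_combination (-(Q - V - v).1) * hy - y'.1 * hpar
        · simp only [Prod.smul_snd, smul_eq_mul]
          linear_combination (-(Q - V - v).2) * hy - y'.2 * hpar
      · refine ⟨-vdet (Q - V - v) y', ?_⟩
        simp only [vdet]
        ext
        · simp only [Prod.smul_fst, smul_eq_mul]
          linear_combination ((Q - V - v).1) * hy + y'.1 * hpar
        · simp only [Prod.smul_snd, smul_eq_mul]
          linear_combination ((Q - V - v).2) * hy + y'.2 * hpar
    obtain ⟨k, hk⟩ := hk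
    refine ⟨k, ?_, by rw [← hk]; abel⟩
    by_contra hneg
    have : σ * vdet x (Q - V) = σ * vdet x v + k * (σ * vdet x y) := by
      have : Q - V = v + k • y := by rw [← hk]; abel
      rw [this]; simp [vdet]; ring
    nlinarith [hQ.1]
  have hval : ∀ k : ℤ, 0 ≤ k → idist (V + v + k • y) X V = σ * vdet x v + k * (σ * vdet x y) := by
    intro k hk
    have e : vdet x (V + v + k • y - V) = vdet x v + k * vdet x y := by simp [vdet]; ring
    rw [hd2, e, habs]
    · ring
    · have : 0 ≤ k * (σ * vdet x y) := mul_nonneg hk (by linarith)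
      linarith
  have hval0 : idist (V + v) X V = σ * vdet x v := by
    have := hval 0 le_rfl
    simpa using this
  constructor
  · rintro ⟨a1, a2, a3⟩
    obtain ⟨k, hk, e⟩ := hcmp P a1 a2
    have h4 := a3 _ hv.1 hv.2
    rw [e, hval k hk, hval0] at h4
    have : k = 0 := by nlinarith
    rw [e, this]; simp
  · rintro rfl
    refine ⟨hv.1, hv.2, ?_⟩
    intro Q hQ hQ1
    obtain ⟨k, hk, e⟩ := hcmp Q hQ hQ1
    rw [e, hval k hk, hval0]
    have : 0 ≤ k * (σ * vdet x y) := mul_nonneg hk (by linarith)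
    linarith

lemma sgn_il {w x P Q : Pt} (hw : vdet w x = 1 ∨ vdet w x = -1) {ℓ c : ℤ} (hℓ : 0 < ℓ)
    (h : Q - P = c • w) : sgnDir (ℓ • w) (Q - P) * il P Q = c := by
  rw [il_prim hw h, h]
  have hw0 : ∀ k : ℤ, k • w = (0, 0) → k = 0 := by
    intro k hk
    have h1 : k * w.1 = 0 := by simpa using congrArg Prod.fst hk
    have h2 : k * w.2 = 0 := by simpa using congrArg Prod.snd hk
    simp only [vdet] at hw
    rcases hw with hw | hw
    · linear_combination (-k) * hw + x.2 * h1 - x.1 * h2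
    · linear_combination k * hw - x.2 * h1 + x.1 * h2
  unfold sgnDir
  by_cases hc : c = 0
  · subst hc; simp
  · rw [if_neg (fun h0 => hc (hw0 c h0))]
    rcases lt_or_gt_of_ne hc with hneg | hpos
    · rw [if_neg, abs_of_neg hneg]
      · ring
      · rintro ⟨s, t, hs, ht, e⟩
        have : (s * c - t * ℓ) • w = (0, 0) := by
          rw [sub_smul, mul_smul, mul_smul, e, sub_self]; rfl
        have := hw0 _ this
        nlinarith [mul_pos ht hℓ]
    · rw [if_pos, abs_of_pos hpos]
      · ring
      · exact ⟨ℓ, c, hℓ, hpos, by rw [← mul_smul, ← mul_smul, mul_comm]⟩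

lemma chord_iff {A B C D u h u' h' : Pt} {l l' : List ℤ} {p q r : ℤ} (hl : ValidLLS l)
    (hl' : ValidLLS l') (hd : vdet u h = 1) (hd' : vdet u' h' = 1) (hp : 0 < p) (hq : 0 < q)
    (hr : 0 < r) (hA : A - B = p • u) (hC : C - B = q • colMap u h (stdPt l))
    (hu' : u' = - colMap u h (stdPt l)) (hD : D - C = r • colMap u' h' (stdPt l')) (k : ℤ) :
    IsChordCurv A B C D k ↔ -h' = colMap u h (vfold l stdI).1 + k • colMap u h (stdPt l) := by
  have hf := valid_facts hl
  have hf' := valid_facts hl'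
  have hgw := vdet_frame hl hd
  have hgw' := vdet_frame hl' hd'
  have huw : vdet u (colMap u h (stdPt l)) = (stdPt l).2 := by
    have : vdet u (colMap u h (stdPt l)) = vdet u h * (stdPt l).2 := by
      simp [vdet, colMap_apply]; ring
    rw [this, hd, one_mul]
  have hug : vdet u (colMap u h (vfold l stdI).1) = (vfold l stdI).1.2 := by
    have : vdet u (colMap u h (vfold l stdI).1) = vdet u h * (vfold l stdI).1.2 := by
      simp [vdet, colMap_apply]; ring
    rw [this, hd, one_mul]
  have hwu' : vdet (colMap u' h' (stdPt l')) u' = -(stdPt l').2 := by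
    have : vdet (colMap u' h' (stdPt l')) u' = -(vdet u' h' * (stdPt l').2) := by
      simp [vdet, colMap_apply]; ring
    rw [this, hd', one_mul]
  have hwh' : vdet (colMap u' h' (stdPt l')) h' = (stdPt l').1 := by
    have : vdet (colMap u' h' (stdPt l')) h' = (vdet u' h' * (stdPt l').1) := by
      simp [vdet, colMap_apply]; ring
    rw [this, hd', one_mul]
  have hB : B - C = q • u' := by rw [hu', smul_neg, ← hC]; abel
  generalize colMap u h (stdPt l) = w at *
  generalize colMap u h (vfold l stdI).1 = g at *
  generalize colMap u' h' (stdPt l') = w' at *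
  generalize colMap u' h' (vfold l' stdI).1 = g' at *
  have hw : vdet w g = 1 ∨ vdet w g = -1 := by
    left; simp only [vdet] at hgw ⊢; linarith
  have hw' : vdet w' g' = 1 ∨ vdet w' g' = -1 := by
    left; simp only [vdet] at hgw' ⊢; linarith
  have N1 := near_iff (X := A) (V := B) (Y := C) (v := w - g) (Or.inl rfl) (Or.inl hd) hw hp hq hA hC
    (by rw [one_mul]; simp only [vdet, Prod.fst_sub, Prod.snd_sub] at hgw ⊢; linarith)
    (by rw [one_mul]
        have : vdet u (w - g) = vdet u w - vdet u g := by simp [vdet]; ring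
        rw [this, huw, hug]; linarith)
    (by rw [one_mul, one_mul]
        have : vdet u (w - g) = vdet u w - vdet u g := by simp [vdet]; ring
        rw [this, huw, hug]; linarith)
  have N2 := near_iff (X := D) (V := C) (Y := B) (v := u' + h') (Or.inr rfl) hw' (Or.inl hd') hr hq hD hB
    (by simp only [vdet, Prod.fst_add, Prod.snd_add] at hd' ⊢; linarith)
    (by have : vdet w' (u' + h') = vdet w' u' + vdet w' h' := by simp [vdet]; ring
        rw [this, hwu', hwh']; linarith)
    (by have : vdet w' (u' + h') = vdet w' u' + vdet w' h' := by simp [vdet]; ring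
        rw [this, hwu', hwh']; linarith)
  -- `h' + g` is a multiple of `w`
  have hpar : vdet (h' + g) w = 0 := by
    subst hu'
    simp only [vdet, Prod.fst_add, Prod.snd_add, Prod.fst_neg, Prod.snd_neg] at hd' hgw ⊢
    linarith
  have hm : ∃ m : ℤ, h' + g = m • w := by
    refine ⟨vdet (h' + g) g, ?_⟩
    have hwg : vdet w g = 1 := by simp only [vdet] at hgw ⊢; linarith
    simp only [vdet] at hwg hpar ⊢
    ext
    · simp only [Prod.smul_fst, smul_eq_mul]
      linear_combination (-(h' + g).1) * hwg - g.1 * hpar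
    · simp only [Prod.smul_snd, smul_eq_mul]
      linear_combination (-(h' + g).2) * hwg - g.2 * hpar
  obtain ⟨m, hm⟩ := hm
  have hw0 : ∀ k : ℤ, k • w = 0 → k = 0 := by
    intro k hk
    have h1 : k * w.1 = 0 := by simpa using congrArg Prod.fst hk
    have h2 : k * w.2 = 0 := by simpa using congrArg Prod.snd hk
    simp only [vdet] at hgw
    linear_combination k * hgw - g.1 * h2 + g.2 * h1
  have hdiff : (C + (u' + h')) - (B + (w - g)) = (q - 2 + m) • w := by
    have : (C + (u' + h')) - (B + (w - g)) = (C - B) + u' - w + (h' + g) := by abel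
    rw [this, hm, hC, hu']
    module
  have hil : il B C = q := by rw [il_prim hw hC, abs_of_pos hq]
  have hval := sgn_il hw hq hdiff
  rw [← hC] at hval
  have hk : IsChordCurv A B C D k ↔ k = -m := by
    constructor
    · rintro ⟨B', C', b1, c1, e⟩
      rw [N1] at b1
      rw [N2] at c1
      subst b1 c1
      rw [hil, hval] at e
      linarith
    · rintro rfl
      refine ⟨_, _, (N1 _).mpr rfl, (N2 _).mpr rfl, ?_⟩
      rw [hil, hval]; ring
  rw [hk]
  have e1 : -h' = g - m • w := by rw [← hm]; abel
  rw [e1]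
  constructor
  · rintro rfl; module
  · intro e
    have : (m + k) • w = 0 := by
      have : (m + k) • w = (g + k • w) - (g - m • w) := by module
      rw [this, e, sub_self]
    have := hw0 _ this
    linarith

/-! ### Half turns and sign changes -/

def UH (v : Pt) : Prop := 0 < v.2 ∨ (v.2 = 0 ∧ v.1 < 0)

open Classical in
noncomputable def cU (ζ : ℕ → Pt) : ℕ → ℕ
  | 0 => 0
  | j + 1 => cU ζ j + if (UH (ζ j) ↔ UH (ζ (j + 1))) then 0 else 1

lemma altCount_append (l : List ℤ) (x y : ℤ) :
    altCount (l ++ [x, y]) = altCount (l ++ [x]) + if x * y < 0 then 1 else 0 := by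
  induction l with
  | nil => simp [altCount]
  | cons a l ih =>
    cases l with
    | nil => simp [altCount]
    | cons b l =>
      simp only [List.cons_append, altCount] at ih ⊢
      rw [ih]; ring

lemma sign_aux (ζ : ℕ → Pt) (n : ℕ) (h0 : ζ 0 = (-1, 0))
    (hdet : ∀ j < n, vdet (ζ j) (ζ (j + 1)) < 0) (m : ℕ) (hm : m < n) :
    ∃ (l : List ℤ) (x : ℤ), ((List.range (m + 1)).map
        (fun j => (-1 : ℤ) ^ j * (ζ (j + 1)).2)).filter (fun x => x != 0) = l ++ [x] ∧
      (UH (ζ (m + 1)) → 0 < (-1) ^ m * x) ∧ (¬ UH (ζ (m + 1)) → (-1) ^ m * x < 0) ∧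
      altCount (l ++ [x]) + cU ζ (m + 1) = m := by
  induction m with
  | zero =>
    have h1 := hdet 0 hm
    rw [h0] at h1
    simp only [vdet, zero_add] at h1
    have h2 : 0 < (ζ 1).2 := by linarith
    have hU1 : UH (ζ 1) := Or.inl h2
    have hU0 : UH (ζ 0) := by rw [h0]; right; simp
    refine ⟨[], (ζ 1).2, ?_, ?_, ?_, ?_⟩
    · simp [h2.ne']
    · intro _; simpa using h2
    · intro h; exact absurd hU1 h
    · simp [altCount, cU, hU1, hU0]
  | succ m ih =>
    obtain ⟨l, x, e, hU, hnU, hc⟩ := ih (by omega)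
    have hd := hdet (m + 1) hm
    simp only [vdet] at hd
    rw [List.range_succ, List.map_append, List.filter_append, e]
    have hsq : (-1 : ℤ) ^ m * (-1) ^ m = 1 := by rw [← mul_pow]; simp
    set s : ℤ := (-1) ^ m with hs
    have hs1 : (-1 : ℤ) ^ (m + 1) = -s := by rw [pow_succ, hs]; ring
    by_cases hy : (ζ (m + 1 + 1)).2 = 0
    · refine ⟨l, x, ?_, ?_, ?_, ?_⟩
      · simp [hy]
      all_goals
        rw [hy] at hd
        have hyx : 0 < (ζ (m + 1)).2 * (ζ (m + 1 + 1)).1 := by linarith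
        rcases pos_and_pos_or_neg_and_neg_of_mul_pos hyx with ⟨p1, p2⟩ | ⟨p1, p2⟩
        · have u1 : UH (ζ (m + 1)) := Or.inl p1
          have u2 : ¬ UH (ζ (m + 1 + 1)) := by rintro (h | ⟨_, h⟩) <;> omega
          have := hU u1
          simp only [cU] at hc ⊢
          simp_all <;> linarith
        · have u1 : ¬ UH (ζ (m + 1)) := by rintro (h | ⟨h, _⟩) <;> omega
          have u2 : UH (ζ (m + 1 + 1)) := Or.inr ⟨hy, p2⟩
          have := hnU u1
          simp only [cU] at hc ⊢
          simp_all <;> linarith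
    · refine ⟨l ++ [x], (-1) ^ (m + 1) * (ζ (m + 1 + 1)).2, ?_, ?_, ?_, ?_⟩
      · simp [hy]
      · intro h
        rcases h with h | ⟨h, _⟩
        · rw [← mul_assoc, hs1]; nlinarith
        · exact absurd h hy
      · intro h
        have h' : (ζ (m + 1 + 1)).2 < 0 := by
          rcases lt_trichotomy (ζ (m + 1 + 1)).2 0 with h1 | h1 | h1
          · exact h1
          · exact absurd h1 hy
          · exact absurd (Or.inl h1) h
        rw [← mul_assoc, hs1]; nlinarith
      · rw [List.append_assoc, List.singleton_append, altCount_append, hs1]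
        rw [show cU ζ (m + 1 + 1) = cU ζ (m + 1) +
          (open Classical in if (UH (ζ (m + 1)) ↔ UH (ζ (m + 1 + 1))) then 0 else 1) from rfl]
        have ex : x * (-s * (ζ (m + 1 + 1)).2) = -((s * x) * (ζ (m + 1 + 1)).2) := by ring
        rw [ex]
        by_cases u1 : UH (ζ (m + 1)) <;> by_cases u2 : UH (ζ (m + 1 + 1))
        · have a1 := hU u1
          have a2 : 0 < (ζ (m + 1 + 1)).2 := by
            rcases u2 with h | ⟨h, _⟩
            · exact h
            · exact absurd h hy
          have : 0 < (s * x) * (ζ (m + 1 + 1)).2 := mul_pos a1 a2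
          rw [if_pos (by linarith), if_pos (iff_of_true u1 u2)]; omega
        · have a1 := hU u1
          have a2 : (ζ (m + 1 + 1)).2 < 0 := by
            by_contra h
            exact u2 (Or.inl (by omega))
          have : (s * x) * (ζ (m + 1 + 1)).2 < 0 := mul_neg_of_pos_of_neg a1 a2
          rw [if_neg (by linarith), if_neg (by tauto)]; omega
        · have a1 := hnU u1
          have a2 : 0 < (ζ (m + 1 + 1)).2 := by
            rcases u2 with h | ⟨h, _⟩
            · exact h
            · exact absurd h hy
          have : (s * x) * (ζ (m + 1 + 1)).2 < 0 := mul_neg_of_neg_of_pos a1 a2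
          rw [if_neg (by linarith), if_neg (by tauto)]; omega
        · have a1 := hnU u1
          have a2 : (ζ (m + 1 + 1)).2 < 0 := by
            by_contra h
            exact u2 (Or.inl (by omega))
          have : 0 < (s * x) * (ζ (m + 1 + 1)).2 := mul_pos_of_neg_of_neg a1 a2
          rw [if_pos (by linarith), if_pos (by tauto)]; omega

lemma sign_count (ζ : ℕ → Pt) (n : ℕ) (hn : 0 < n) (h0 : ζ 0 = (-1, 0))
    (hdet : ∀ j < n, vdet (ζ j) (ζ (j + 1)) < 0) :
    signChanges ((List.range n).map (fun j => (-1 : ℤ) ^ j * (ζ (j + 1)).2)) + cU ζ n = n - 1 := by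
  obtain ⟨m, rfl⟩ : ∃ m, n = m + 1 := ⟨n - 1, by omega⟩
  obtain ⟨l, x, e, _, _, h⟩ := sign_aux ζ (m + 1) h0 hdet m (by omega)
  rw [signChanges, e, h]; omega

lemma cU_mono (ζ : ℕ → Pt) : Monotone (cU ζ) := by
  apply monotone_nat_of_le_succ
  intro j; simp [cU]

lemma cU_even (ζ : ℕ → Pt) (h0 : UH (ζ 0)) (j : ℕ) : UH (ζ j) ↔ cU ζ j % 2 = 0 := by
  induction j with
  | zero => simp [cU, h0]
  | succ j ih =>
    simp only [cU]
    split_ifs with h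
    · rw [← h, ih]; simp
    · have : ¬ (UH (ζ j) ↔ UH (ζ (j+1))) := h
      rw [ih] at this
      by_cases u : UH (ζ (j + 1)) <;> simp only [u, iff_true, iff_false, true_iff, false_iff] at this ⊢ <;> omega

/-- the pattern of one full turn -/
structure OneTurn (ζ : ℕ → Pt) (n : ℕ) : Prop where
  zero : ζ 0 = (-1, 0)
  last : ζ n = (-1, 0)
  det : ∀ j < n, vdet (ζ j) (ζ (j + 1)) < 0
  down : ∀ r s, r < s → s < n → UH (ζ s) → UH (ζ r)
  pen : (ζ (n - 1)).2 < 0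

lemma oneTurn_of_cU (ζ : ℕ → Pt) (n : ℕ) (hn : 0 < n) (h0 : ζ 0 = (-1, 0)) 
    (hdet : ∀ j < n, vdet (ζ j) (ζ (j + 1)) < 0) (hy : (ζ n).2 = 0)
    (hprim : (ζ n).1 = 1 ∨ (ζ n).1 = -1) (hc : cU ζ n = 2) : OneTurn ζ n := by
  have hU0 : UH (ζ 0) := by rw [h0]; right; simp
  have hUn : UH (ζ n) := (cU_even ζ hU0 n).mpr (by rw [hc])
  have hx : (ζ n).1 < 0 := by
    rcases hUn with h | h
    · omega
    · exact h.2
  have hpen : (ζ (n - 1)).2 < 0 := by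
    have := hdet (n - 1) (by omega)
    rw [Nat.sub_add_cancel hn] at this
    simp only [vdet, hy] at this
    nlinarith
  have hcp : cU ζ (n - 1) ≤ 1 := by
    have h1 : ¬ UH (ζ (n - 1)) := by rintro (h | ⟨h, _⟩) <;> omega
    rw [cU_even ζ hU0] at h1
    have := cU_mono ζ (show n - 1 ≤ n by omega)
    omega
  refine ⟨h0, ?_, hdet, ?_, hpen⟩
  · ext
    · simp; omega
    · exact hy
  · intro r s hrs hsn hs
    rw [cU_even ζ hU0] at hs ⊢
    have h1 := cU_mono ζ (show s ≤ n - 1 by omega)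
    have h2 := cU_mono ζ hrs.le
    omega

lemma trans_UH {a b c : Pt} (ha : UH a) (hb : UH b) (hc : UH c) (h1 : vdet a b < 0)
    (h2 : vdet b c < 0) : vdet a c < 0 := by
  obtain ⟨a1, a2⟩ := a
  obtain ⟨b1, b2⟩ := b
  obtain ⟨c1, c2⟩ := c
  simp only [UH, vdet] at *
  have key : b2 * (a1 * c2 - a2 * c1) = c2 * (a1 * b2 - a2 * b1) + a2 * (b1 * c2 - b2 * c1) := by
    ring
  rcases hb with hb | ⟨rfl, hb⟩
  · rcases ha with ha | ⟨rfl, ha⟩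
    · have : a2 * (b1 * c2 - b2 * c1) < 0 := by nlinarith
      have hc' : 0 ≤ c2 := by omega
      have : c2 * (a1 * b2 - a2 * b1) ≤ 0 := by nlinarith
      nlinarith
    · rcases hc with hc | ⟨rfl, hc⟩
      · nlinarith
      · nlinarith
  · have : 0 ≤ a2 := by omega
    nlinarith

lemma UH_neg {v : Pt} (hv : v ≠ 0) (h : ¬ UH v) : UH (-v) := by
  obtain ⟨x, y⟩ := v
  simp only [UH, Prod.neg_mk] at *
  have : x ≠ 0 ∨ y ≠ 0 := by
    by_contra hh
    push Not at hh
    exact hv (by rw [hh.1, hh.2]; rfl)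
  omega

lemma not_UH_neg {v : Pt} (h : UH (-v)) : ¬ UH v := by
  obtain ⟨x, y⟩ := v
  simp only [UH, Prod.neg_mk] at *
  omega

lemma vdet_neg_neg (a b : Pt) : vdet (-a) (-b) = vdet a b := by simp [vdet]

lemma ne_zero_of_vdet {a b : Pt} (h : vdet a b < 0) : a ≠ 0 := by
  rintro rfl; simp [vdet] at h

lemma cone_UH {a b v : Pt} (hv : v ≠ 0) (ha : UH a) (hb : UH b) (hab : vdet a b < 0)
    (h1 : 0 ≤ vdet v a) (h2 : vdet v b ≤ 0) : UH v := by
  obtain ⟨a1, a2⟩ := a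
  obtain ⟨b1, b2⟩ := b
  obtain ⟨x, y⟩ := v
  have hxy : x ≠ 0 ∨ y ≠ 0 := by
    by_contra hh
    push Not at hh
    exact hv (by rw [hh.1, hh.2]; rfl)
  simp only [UH, vdet] at *
  have k1 : (a1 * b2 - a2 * b1) * x = (x * b2 - y * b1) * a1 - (x * a2 - y * a1) * b1 := by ring
  have k2 : (a1 * b2 - a2 * b1) * y = (x * b2 - y * b1) * a2 - (x * a2 - y * a1) * b2 := by ring
  generalize (a1 * b2 - a2 * b1) = N at *
  generalize (x * b2 - y * b1) = α at *
  generalize (x * a2 - y * a1) = β at *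
  have ha2 : 0 ≤ a2 := by omega
  have hb2 : 0 ≤ b2 := by omega
  have m1 : α * a2 ≤ 0 := by nlinarith
  have m2 : 0 ≤ β * b2 := by positivity
  have hy : 0 ≤ y := by
    by_contra h
    have : 0 < N * y := mul_pos_of_neg_of_neg hab (by omega)
    linarith
  rcases hy.lt_or_eq with hy | hy
  · exact Or.inl hy
  · right
    refine ⟨hy.symm, ?_⟩
    subst hy
    have m3 : α * a2 = 0 := by linarith
    have m4 : β * b2 = 0 := by linarith
    have m5 : 0 ≤ α * a1 := by
      rcases mul_eq_zero.mp m3 with h | h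
      · simp [h]
      · have : a1 < 0 := by omega
        nlinarith
    have m6 : β * b1 ≤ 0 := by
      rcases mul_eq_zero.mp m4 with h | h
      · simp [h]
      · have : b1 < 0 := by omega
        nlinarith
    have : 0 ≤ N * x := by linarith
    have hx : x ≤ 0 := by
      by_contra h
      have : N * x < 0 := mul_neg_of_neg_of_pos hab (by omega)
      linarith
    omega

namespace OneTurn

variable {ζ : ℕ → Pt} {n : ℕ}

lemma ne (h : OneTurn ζ n) {s : ℕ} (hs : s < n) : ζ s ≠ 0 := ne_zero_of_vdet (h.det s hs)

lemma sorted (h : OneTurn ζ n) {r s : ℕ} (hrs : r < s) (hs : s < n)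
    (hU : UH (ζ r) ↔ UH (ζ s)) : vdet (ζ r) (ζ s) < 0 := by
  obtain ⟨d, rfl⟩ := Nat.exists_eq_add_of_lt hrs
  clear hrs
  induction d with
  | zero => exact h.det r (by omega)
  | succ d ih =>
    have hd := h.det (r + d + 1) (by omega)
    rw [show r + (d + 1) + 1 = r + d + 1 + 1 by ring] at *
    by_cases u : UH (ζ r)
    · have u2 := hU.mp u
      have u1 := h.down (r + d + 1) _ (by omega) hs u2
      exact trans_UH u u1 u2 (ih (by omega) (iff_of_true u u1)) hd
    · have u2 : ¬ UH (ζ (r + d + 1 + 1)) := by tauto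
      have u1 : ¬ UH (ζ (r + d + 1)) := fun h' => u (h.down r _ (by omega) (by omega) h')
      rw [← vdet_neg_neg]
      refine trans_UH (UH_neg (h.ne (by omega)) u) (UH_neg (h.ne (by omega)) u1)
        (UH_neg (h.ne hs) u2) ?_ ?_
      · rw [vdet_neg_neg]; exact ih (by omega) (by tauto)
      · rw [vdet_neg_neg]; exact hd

lemma nocone (h : OneTurn ζ n) {r s : ℕ} (hr : r < n) (hs : s < n) (h1 : s ≠ r) (h2 : s ≠ r + 1)
    (h3 : ¬ (r + 1 = n ∧ s = 0)) (hd : 0 ≤ vdet (ζ s) (ζ r)) : 0 < vdet (ζ s) (ζ (r + 1)) := by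
  by_contra hd2
  push Not at hd2
  have hsw : ∀ a b : Pt, vdet a b = - vdet b a := by intro a b; simp [vdet]; ring
  have hdr := h.det r hr
  by_cases us : UH (ζ s)
  · rcases lt_or_gt_of_ne h1 with hlt | hgt
    · by_cases ur : UH (ζ r)
      · have := h.sorted hlt hr (iff_of_true us ur); linarith
      · by_cases hrn : r + 1 = n
        · have hU0 : UH (ζ 0) := by rw [h.zero]; right; simp
          have := h.sorted (r := 0) (s := s) (by omega) hs (iff_of_true hU0 us)
          rw [hrn, h.last, ← h.zero, hsw] at hd2
          linarith
        · have ur1 : ¬ UH (ζ (r + 1)) := fun h' => ur (h.down r _ (by omega) (by omega) h')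
          have := cone_UH (neg_ne_zero.mpr (h.ne hs)) (UH_neg (h.ne hr) ur)
            (UH_neg (h.ne (by omega)) ur1) (by rw [vdet_neg_neg]; exact hdr)
            (by rw [vdet_neg_neg]; exact hd) (by rw [vdet_neg_neg]; exact hd2)
          exact not_UH_neg this us
    · have ur1 := h.down (r + 1) s (by omega) hs us
      have := h.sorted (r := r + 1) (s := s) (by omega) hs (iff_of_true ur1 us)
      rw [hsw] at hd2; linarith
  · rcases lt_or_gt_of_ne h1 with hlt | hgt
    · have ur : ¬ UH (ζ r) := fun h' => us (h.down s r hlt hr h')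
      have := h.sorted hlt hr (by tauto); linarith
    · by_cases ur1 : UH (ζ (r + 1))
      · have ur := h.down r (r + 1) (by omega) (by omega) ur1
        exact us (cone_UH (h.ne hs) ur ur1 hdr hd hd2)
      · have := h.sorted (r := r + 1) (s := s) (by omega) hs (by tauto)
        rw [hsw] at hd2; linarith

end OneTurn

lemma convex_of_edges (n : ℕ) (hn : 3 ≤ n) (e A : ZMod n → Pt) (ℓ : ZMod n → ℤ)
    (hℓ : ∀ i, 0 < ℓ i) (hA : ∀ i, A (i + 1) - A i = ℓ i • e i)
    (hdet : ∀ i, vdet (e i) (e (i + 1)) < 0)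
    (hQ : ∀ i k, k ≠ i → k + 1 ≠ i → 0 ≤ vdet (e i) (e k) → 0 < vdet (e i) (e (k + 1))) :
    ConvexPolygon n A := by
  intro i j hj hj1
  have : NeZero n := ⟨by omega⟩
  set G : ℕ → ℤ := fun m => vdet (e i) (A (i + (m : ZMod n)) - A i) with hG
  have hstep : ∀ m : ℕ, G (m + 1) = G m + ℓ (i + m) * vdet (e i) (e (i + (m : ZMod n))) := by
    intro m
    have e1 : A (i + ((m + 1 : ℕ) : ZMod n)) - A i
        = (A (i + (m : ZMod n)) - A i) + ℓ (i + m) • e (i + m) := by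
      rw [← hA]; push_cast; rw [add_assoc]; abel
    simp only [hG]
    rw [e1]; simp [vdet]; ring
  have hcast : ∀ m : ℕ, 0 < m → m < n → (m : ZMod n) ≠ 0 := by
    intro m h0 h1 h2
    rw [ZMod.natCast_eq_zero_iff] at h2
    exact absurd (Nat.le_of_dvd h0 h2) (by omega)
  have hG0 : G 0 = 0 := by simp [hG, vdet]
  have hG1 : G 1 = 0 := by
    have := hstep 0
    rw [hG0] at this
    rw [zero_add] at this
    rw [this]; simp [vdet]; right; ring
  have hGn : G n = 0 := by simp [hG, vdet]
  have hgood : ∀ m : ℕ, 1 ≤ m → m + 1 < n → 0 ≤ vdet (e i) (e (i + (m : ZMod n))) →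
      0 < vdet (e i) (e (i + ((m + 1 : ℕ) : ZMod n))) := by
    intro m h1 h2 h3
    have := hQ i (i + m) (by simpa using hcast m (by omega) (by omega))
      (by
        rw [add_assoc]
        have := hcast (m + 1) (by omega) (by omega)
        push_cast at this
        simpa using this) h3
    push_cast
    rwa [← add_assoc]
  have hbad : ∀ m d : ℕ, 1 ≤ m → m + d + 1 < n → 0 ≤ G (m + 1) →
      0 ≤ vdet (e i) (e (i + (m : ZMod n))) →
      0 < G (m + d + 2) ∧ 0 < vdet (e i) (e (i + ((m + d + 1 : ℕ) : ZMod n))) := by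
    intro m d
    induction d with
    | zero =>
      intro h1 h2 h3 h4
      have h5 := hgood m h1 h2 h4
      refine ⟨?_, h5⟩
      have := hstep (m + 1)
      have h6 := mul_pos (hℓ (i + ((m + 1 : ℕ) : ZMod n))) h5
      rw [show m + 0 + 2 = m + 1 + 1 by ring, this]
      linarith
    | succ d ih =>
      intro h1 h2 h3 h4
      obtain ⟨h5, h6⟩ := ih h1 (by omega) h3 h4
      have h7 := hgood (m + d + 1) (by omega) (by omega) h6.le
      refine ⟨?_, h7⟩
      have := hstep (m + d + 1 + 1)
      have h8 := mul_pos (hℓ (i + ((m + d + 1 + 1 : ℕ) : ZMod n))) h7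
      rw [show m + (d + 1) + 2 = m + d + 1 + 1 + 1 by ring, this]
      have : m + d + 2 = m + d + 1 + 1 := by ring
      rw [this] at h5
      linarith
  have hneg : ∀ m : ℕ, m + 2 < n → G (m + 2) < 0 := by
    intro m
    induction m with
    | zero =>
      intro _
      have := hstep 1
      rw [hG1] at this
      have h1 := mul_neg_of_pos_of_neg (hℓ (i + ((1 : ℕ) : ZMod n))) (by simpa using hdet i :
        vdet (e i) (e (i + ((1 : ℕ) : ZMod n))) < 0)
      rw [zero_add, show (2 : ℕ) = 1 + 1 from rfl, this]
      linarith
    | succ m ih =>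
      intro hm
      have h1 := ih (by omega)
      by_contra hc
      push Not at hc
      have h2 := hstep (m + 2)
      rw [show m + 1 + 2 = m + 2 + 1 by ring] at hc
      have h3 : 0 < ℓ (i + ((m + 2 : ℕ) : ZMod n)) * vdet (e i) (e (i + ((m + 2 : ℕ) : ZMod n))) := by
        linarith
      have h4 := (pos_iff_pos_of_mul_pos h3).mp (hℓ _)
      obtain ⟨d, hd⟩ : ∃ d, n = m + 2 + d + 2 := ⟨n - m - 4, by omega⟩
      have := (hbad (m + 2) d (by omega) (by omega) hc h4.le).1
      rw [← hd, hGn] at this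
      exact absurd this (lt_irrefl _)
  have hm1 : (j - i).val < n := ZMod.val_lt _
  have hcj : (((j - i).val : ℕ) : ZMod n) = j - i := ZMod.natCast_zmod_val _
  have hm2 : (j - i).val ≠ 0 := by
    intro h
    rw [h] at hcj
    apply hj
    have : j - i = 0 := by rw [← hcj]; simp
    exact sub_eq_zero.mp this
  have hm3 : (j - i).val ≠ 1 := by
    intro h
    rw [h] at hcj
    apply hj1
    have : j - i = 1 := by rw [← hcj]; simp
    rw [← this]; ring
  obtain ⟨m, hm⟩ : ∃ m, (j - i).val = m + 2 := ⟨(j - i).val - 2, by omega⟩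
  have h1 := hneg m (by omega)
  rw [hm] at hcj
  simp only [hG, hcj] at h1
  rw [show i + (j - i) = j by ring] at h1
  rw [hA]
  have : vdet (ℓ i • e i) (A j - A i) = ℓ i * vdet (e i) (A j - A i) := by simp [vdet]; ring
  rw [this]
  exact mul_neg_of_pos_of_neg (hℓ i) h1

/-- positive relation between edges -/
lemma OneTurn.relation {ζ : ℕ → Pt} {n : ℕ} (hn : 3 ≤ n) (h : OneTurn ζ n) :
    ∃ ℓ : ℕ → ℤ, (∀ j, 0 < ℓ j) ∧ ∑ j ∈ Finset.range n, ℓ j • ζ (j + 1) = 0 := by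
  classical
  let S : AddSubmonoid Pt :=
    { carrier := {v | ∃ c : ℕ → ℤ, (∀ j, 0 ≤ c j) ∧ ∑ j ∈ Finset.range n, c j • ζ (j + 1) = v}
      zero_mem' := ⟨fun _ => 0, fun _ => le_rfl, by simp⟩
      add_mem' := by
        rintro a b ⟨c, hc, rfl⟩ ⟨d, hd, rfl⟩
        refine ⟨fun j => c j + d j, fun j => add_nonneg (hc j) (hd j), ?_⟩
        simp only [add_smul, Finset.sum_add_distrib] }
  have hsm : ∀ (k : ℤ) (v : Pt), 0 ≤ k → v ∈ S → k • v ∈ S := by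
    rintro k v hk ⟨c, hc, rfl⟩
    refine ⟨fun j => k * c j, fun j => mul_nonneg hk (hc j), ?_⟩
    simp only [mul_smul, Finset.smul_sum]
  have hmem : ∀ j < n, ζ (j + 1) ∈ S := by
    intro j hj
    refine ⟨fun i => if i = j then 1 else 0, fun i => by dsimp only; split_ifs <;> norm_num, ?_⟩
    simp [Finset.sum_ite_eq', hj]
  have ho : ((-1, 0) : Pt) ∈ S := by
    have := hmem (n - 1) (by omega)
    rwa [Nat.sub_add_cancel (by omega), h.last] at this
  have hcm := hmem (n - 2) (by omega)
  rw [show n - 2 + 1 = n - 1 by omega] at hcm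
  have hU0 : UH (ζ 0) := by rw [h.zero]; right; simp
  have hUl : ¬ UH (ζ (n - 1)) := by
    have := h.pen
    rintro (h | ⟨h, _⟩) <;> omega
  have hex : ∃ p, p + 1 < n ∧ UH (ζ p) ∧ ¬ UH (ζ (p + 1)) := by
    by_contra hne
    push Not at hne
    have : ∀ p, p < n → UH (ζ p) := by
      intro p
      induction p with
      | zero => intro _; exact hU0
      | succ p ih => intro hp; exact hne p hp (ih (by omega))
    exact hUl (this _ (by omega))
  obtain ⟨p, hp, ua, ub⟩ := hex
  have hdab := h.det p (by omega)
  have hb2 : (ζ (p + 1)).2 ≤ 0 := by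
    by_contra hh
    exact ub (Or.inl (by omega))
  have ha2 : 0 < (ζ p).2 := by
    rcases ua with ua | ⟨ua, ua'⟩
    · exact ua
    · simp only [vdet, ua] at hdab
      nlinarith
  have hp0 : p ≠ 0 := by
    rintro rfl
    rw [h.zero] at ha2; simp at ha2
  have ham := hmem (p - 1) (by omega)
  rw [Nat.sub_add_cancel (by omega)] at ham
  have hbm := hmem p (by omega)
  have hhor : (((-vdet (ζ p) (ζ (p + 1)), 0)) : Pt) ∈ S := by
    have := S.add_mem (hsm (-(ζ (p + 1)).2) _ (by omega) ham) (hsm (ζ p).2 _ ha2.le hbm)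
    convert this using 1
    ext <;> simp [vdet] <;> ring
  set N := -vdet (ζ p) (ζ (p + 1)) with hN
  have hNpos : 0 < N := by omega
  -- horizontal vectors
  have hh : ∀ Z : ℤ, N • ((Z, 0) : Pt) ∈ S := by
    intro Z
    rcases le_total 0 Z with hZ | hZ
    · have := hsm Z _ hZ hhor
      convert this using 1
      ext <;> simp [mul_comm]
    · have := hsm (N * (-Z)) _ (mul_nonneg hNpos.le (by omega)) ho
      convert this using 1
      ext <;> simp
  have hpen := h.pen
  -- all vectors
  have hall : ∀ v : Pt, ∃ M : ℤ, 0 < M ∧ M • v ∈ S := by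
    intro v
    rcases le_total 0 v.2 with hv | hv
    · refine ⟨N * (ζ p).2, mul_pos hNpos ha2, ?_⟩
      have := S.add_mem (hsm (N * v.2) _ (mul_nonneg hNpos.le hv) ham)
        (hh ((ζ p).2 * v.1 - v.2 * (ζ p).1))
      convert this using 1
      ext <;> simp <;> ring
    · refine ⟨N * -(ζ (n - 1)).2, mul_pos hNpos (by omega), ?_⟩
      have := S.add_mem (hsm (N * -v.2) _ (mul_nonneg hNpos.le (by omega)) hcm)
        (hh (-(ζ (n - 1)).2 * v.1 + v.2 * (ζ (n - 1)).1))
      convert this using 1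
      ext <;> simp <;> ring
  obtain ⟨M, hM, c, hc, hsum⟩ := hall (-∑ j ∈ Finset.range n, ζ (j + 1))
  refine ⟨fun j => M + c j, fun j => by have := hc j; dsimp only; omega, ?_⟩
  simp only [add_smul, Finset.sum_add_distrib, hsum, ← Finset.smul_sum]
  rw [smul_neg, add_neg_cancel]

/-! ### Assembly -/

lemma zmod_val_succ {n : ℕ} (hn : 3 ≤ n) (x : ZMod n) :
    (x + 1).val = if x.val + 1 = n then 0 else x.val + 1 := by
  have : NeZero n := ⟨by omega⟩
  have : Fact (1 < n) := ⟨by omega⟩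
  rw [ZMod.val_add, ZMod.val_one]
  have := ZMod.val_lt x
  split_ifs with h
  · rw [h, Nat.mod_self]
  · exact Nat.mod_eq_of_lt (by omega)

lemma wrap {n : ℕ} (hn : 3 ≤ n) {α : Type*} (f : ℕ → α) (hf : f n = f 0) (x : ZMod n) :
    f (x + 1).val = f (x.val + 1) := by
  rw [zmod_val_succ hn]
  split_ifs with h
  · rw [h, hf]
  · rfl

lemma zt_prim (L : ℕ → List ℤ) (κ : ℕ → ℤ) (n : ℕ) (hL : ∀ i < n, ValidLLS (L i))
    (h : (zt L κ n).2 = 0) : (zt L κ n).1 = 1 ∨ (zt L κ n).1 = -1 := by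
  have h1 := Fr_det L κ n hL
  have e : (Fr L κ n).1 = - zt L κ n := by simp [zt]
  rw [e] at h1
  simp only [vdet, Prod.fst_neg, Prod.snd_neg, h] at h1
  have : (zt L κ n).1 * (-(Fr L κ n).2.2) = 1 := by linarith
  exact Int.isUnit_iff.mp (IsUnit.of_mul_eq_one _ this)

lemma cond_eq (n : ℕ) (L : ℕ → List ℤ) (κ : ℕ → ℤ) :
    ((List.range n).map fun j => cont (llsCat L κ 0 j)) =
      (List.range n).map (fun j => (-1 : ℤ) ^ j * (zt L κ (j + 1)).2) := by
  simp only [cont_llsCat]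

lemma backward (n : ℕ) (hn : 3 ≤ n) (L : ℕ → List ℤ) (κ : ℕ → ℤ)
    (hL : ∀ i < n, ValidLLS (L i)) (h : OneTurn (zt L κ) n) (hF : Fr L κ n = stdI) :
    ∃ A : ZMod n → Pt, ConvexPolygon n A ∧ HasACS n A L κ := by
  have : NeZero n := ⟨by omega⟩
  obtain ⟨ℓ, hℓ, hsum⟩ := h.relation hn
  have hFw := wrap hn (Fr L κ) (by rw [hF]; rfl)
  have hzw : ∀ x : ZMod n, zt L κ (x + 1).val = zt L κ (x.val + 1) := by
    intro x; simp only [zt, hFw]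
  set A : ZMod n → Pt := fun x => ∑ k ∈ Finset.range x.val, ℓ k • zt L κ (k + 1) with hAdef
  have hA : ∀ x, A (x + 1) - A x = ℓ x.val • zt L κ (x.val + 1) := by
    intro x
    have := wrap hn (fun m => ∑ k ∈ Finset.range m, ℓ k • zt L κ (k + 1)) (by rw [hsum]; simp) x
    simp only [hAdef]
    rw [this, Finset.sum_range_succ]; abel
  have hAm : ∀ x, A (x - 1) - A x = ℓ (x - 1).val • (Fr L κ x.val).1 := by
    intro x
    have := hA (x - 1)
    rw [sub_add_cancel, ← hzw, sub_add_cancel] at this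
    rw [← neg_sub, this, zt]; simp
  have hAp : ∀ x, A (x + 1) - A x = ℓ x.val •
      colMap (Fr L κ x.val).1 (Fr L κ x.val).2 (stdPt (L x.val)) := by
    intro x
    rw [hA, zt_succ' _ _ _ (hL _ (ZMod.val_lt x))]
  have hdF : ∀ x : ZMod n, vdet (Fr L κ x.val).1 (Fr L κ x.val).2 = 1 := fun x =>
    Fr_det L κ _ (fun i hi => hL i (by have := ZMod.val_lt x; omega))
  refine ⟨A, ?_, ?_⟩
  · refine convex_of_edges n hn (fun x => zt L κ (x.val + 1)) A (fun x => ℓ x.val)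
      (fun x => hℓ _) hA ?_ ?_
    · intro i
      rw [← hzw i]
      exact h.det _ (ZMod.val_lt _)
    · intro i k hki hki1
      rw [← hzw i, ← hzw k]
      have hv := zmod_val_succ hn (k + 1)
      have hne : (i + 1).val ≠ (k + 1 + 1).val := by
        intro e
        apply hki1
        have := ZMod.val_injective n e
        exact (add_right_cancel this).symm
      refine h.nocone (ZMod.val_lt _) (ZMod.val_lt _) ?_ ?_ ?_
      · intro e
        have := ZMod.val_injective n e
        exact hki (add_right_cancel this).symm
      · intro e
        have h1 := ZMod.val_lt (i + 1)
        rw [if_neg (by omega)] at hv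
        omega
      · rintro ⟨e1, e2⟩
        rw [if_pos e1] at hv
        omega
  · intro i hi
    have hiv : ((i : ℕ) : ZMod n).val = i := ZMod.val_natCast_of_lt hi
    generalize ((i : ℕ) : ZMod n) = x at *
    subst hiv
    have hLx := hL _ (ZMod.val_lt x)
    constructor
    · exact frame_lls hLx (hdF x) (hℓ _) (hℓ _) (hAm x) (hAp x)
    · have e2 : x + 2 = x + 1 + 1 := by ring
      rw [e2]
      rw [chord_iff (l := L x.val) (l' := L (x + 1).val) hLx (hL _ (ZMod.val_lt _)) (hdF x)
        (hdF (x + 1)) (hℓ _) (hℓ _) (hℓ _) (hAm x) (hAp x) ?_ (hAp (x + 1))]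
      · rw [hFw]
        simp only [Fr, vstep]
        rw [vfold_eq, vfold_std _ (valid_ne hLx)]
        simp only [Prod.snd_neg, neg_neg]
      · rw [hFw]
        simp only [Fr, vstep]
        rw [vfold_eq, vfold_std _ (valid_ne hLx)]
        simp only [Prod.fst_neg]

lemma heights {n : ℕ} {A : ZMod n → Pt} (hA : ConvexPolygon n A) {i : ZMod n}
    (hi0 : i ≠ 0) (hi1 : i + 1 ≠ 0) (hii : i - 1 ≠ i) (hii2 : i - 1 ≠ i + 1)
    (h : vdet (A (-1) - A 0) (A i - A (i - 1)) ≤ 0) :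
    vdet (A (-1) - A 0) (A (i + 1) - A i) < 0 := by
  have c1 := hA (-1) i (fun e => hi1 (by rw [e]; ring)) (by simpa using hi0)
  rw [neg_add_cancel] at c1
  have c2 := hA i 0 hi0.symm hi1.symm
  have c3 := hA i (i - 1) hii hii2
  have c4 : 0 ≤ vdet (A (i - 1) - A i) (A 0 - A i) := by
    by_cases e : i - 1 = 0
    · rw [e]; simp [vdet]; linarith
    · have := hA (i - 1) 0 (Ne.symm e) (by rw [sub_add_cancel]; exact hi0.symm)
      rw [sub_add_cancel] at this
      simp only [vdet, Prod.fst_sub, Prod.snd_sub] at this ⊢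
      linarith
  by_contra hc
  push Not at hc
  generalize A (-1) = M at *
  generalize A 0 = O at *
  generalize A i = P at *
  generalize A (i - 1) = X at *
  generalize A (i + 1) = Y at *
  have d1 : 0 < vdet (M - O) (P - O) := by
    simp only [vdet, Prod.fst_sub, Prod.snd_sub] at c1 ⊢
    linarith
  have d2 : 0 < vdet (X - P) (Y - P) := by
    simp only [vdet, Prod.fst_sub, Prod.snd_sub] at c3 ⊢
    linarith
  have d3 : 0 < vdet (O - P) (Y - P) := by
    simp only [vdet, Prod.fst_sub, Prod.snd_sub] at c2 ⊢
    linarith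
  have key : vdet (X - P) (Y - P) * vdet (M - O) (P - O) =
      vdet (O - P) (Y - P) * vdet (M - O) (P - X)
      - vdet (X - P) (O - P) * vdet (M - O) (Y - P) := by
    simp only [vdet, Prod.fst_sub, Prod.snd_sub]; ring
  nlinarith [mul_pos d2 d1, mul_nonneg c4 hc]

lemma forward (n : ℕ) (hn : 3 ≤ n) (L : ℕ → List ℤ) (κ : ℕ → ℤ)
    (hL : ∀ i < n, ValidLLS (L i)) (A : ZMod n → Pt) (hA : ConvexPolygon n A)
    (hS : HasACS n A L κ) : Fr L κ n = stdI ∧ cU (zt L κ) n = 2 := by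
  have : NeZero n := ⟨by omega⟩
  have hcast : ∀ m : ℕ, 0 < m → m < n → (m : ZMod n) ≠ 0 := by
    intro m h0 h1 h2
    rw [ZMod.natCast_eq_zero_iff] at h2
    exact absurd (Nat.le_of_dvd h0 h2) (by omega)
  have h1ne : (1 : ZMod n) ≠ 0 := by simpa using hcast 1 (by omega) (by omega)
  have h2ne : (2 : ZMod n) ≠ 0 := by simpa using hcast 2 (by omega) (by omega)
  have hm1 : ∀ x : ZMod n, x - 1 ≠ x := by
    intro x e
    apply h1ne
    linear_combination -e
  have hm2 : ∀ x : ZMod n, x - 1 ≠ x + 1 := by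
    intro x e
    apply h2ne
    linear_combination -e
  have hS' : ∀ x : ZMod n, IsLLSOfAngle (A (x - 1)) (A x) (A (x + 1)) (L x.val) ∧
      IsChordCurv (A (x - 1)) (A x) (A (x + 1)) (A (x + 2)) (κ x.val) := by
    intro x
    have := hS x.val (ZMod.val_lt x)
    rwa [ZMod.natCast_zmod_val] at this
  have hfr : ∀ x : ZMod n, ∃ (u h : Pt) (p q : ℤ), vdet u h = 1 ∧ 0 < p ∧ 0 < q ∧
      A (x - 1) - A x = p • u ∧ A (x + 1) - A x = q • colMap u h (stdPt (L x.val)) := by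
    intro x
    apply lls_frame (hS' x).1
    have := hA x (x - 1) (hm1 x) (hm2 x)
    simp only [vdet, Prod.fst_sub, Prod.snd_sub] at this ⊢
    linarith
  choose u h p q hd hp hq hu hw using hfr
  have hval : ∀ x : ZMod n, ValidLLS (L x.val) := fun x => hL _ (ZMod.val_lt x)
  have hux : ∀ x, u (x + 1) = - colMap (u x) (h x) (stdPt (L x.val)) := by
    intro x
    have e1 := hu (x + 1)
    rw [add_sub_cancel_right] at e1
    have e2 := hw x
    refine prim_unique (x := h (x + 1)) (x' := colMap (u x) (h x) (vfold (L x.val) stdI).1)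
      (Or.inl (hd _)) (Or.inr ?_) (hp (x + 1)) (hq x) ?_
    · have := vdet_frame (hval x) (hd x)
      simp only [vdet, Prod.fst_neg, Prod.snd_neg] at this ⊢
      linarith
    · rw [← e1, smul_neg, ← e2]; abel
  have hhx : ∀ x, -h (x + 1) = colMap (u x) (h x) (vfold (L x.val) stdI).1
      + κ x.val • colMap (u x) (h x) (stdPt (L x.val)) := by
    intro x
    have hc := (hS' x).2
    rw [show x + 2 = x + 1 + 1 by ring] at hc
    exact (chord_iff (hval x) (hval (x + 1)) (hd x) (hd (x + 1)) (hp x) (hq x) (hq (x + 1)) (hu x)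
      (hw x) (hux x) (hw (x + 1)) _).mp hc
  -- transport of the standard frames
  have hT : ∀ j : ℕ, j ≤ n → colMap (u 0) (h 0) (Fr L κ j).1 = u (j : ZMod n) ∧
      colMap (u 0) (h 0) (Fr L κ j).2 = h (j : ZMod n) := by
    intro j
    induction j with
    | zero => intro _; simp [Fr, stdI, colMap_apply]
    | succ j ih =>
      intro hj
      obtain ⟨i1, i2⟩ := ih (by omega)
      have hjv : ((j : ℕ) : ZMod n).val = j := ZMod.val_natCast_of_lt (by omega)
      have hv := vfold_map (colMap (u 0) (h 0)) (L j) (Fr L κ j)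
      rw [i1, i2, vfold_eq, vfold_std _ (valid_ne (hL j (by omega)))] at hv
      have e1 := congrArg Prod.fst hv
      have e2 := congrArg Prod.snd hv
      dsimp only at e1 e2
      have a1 := hux (j : ZMod n)
      have a2 := hhx (j : ZMod n)
      rw [hjv] at a1 a2
      push_cast
      simp only [Fr, vstep, Prod.fst_neg, Prod.snd_neg, map_neg, map_add, map_zsmul]
      rw [← e1, ← e2, ← a2, ← a1]
      simp
  have hinj : ∀ P Q : Pt, colMap (u 0) (h 0) P = colMap (u 0) (h 0) Q → P = Q := by
    intro P Q e
    have t1 : ∀ P : Pt, vdet (u 0) (colMap (u 0) (h 0) P) = vdet (u 0) (h 0) * P.2 := by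
      intro P; simp [vdet, colMap_apply]; ring
    have t2 : ∀ P : Pt, vdet (colMap (u 0) (h 0) P) (h 0) = vdet (u 0) (h 0) * P.1 := by
      intro P; simp [vdet, colMap_apply]; ring
    have b1 := t1 P
    have b2 := t2 P
    rw [e, t1, hd] at b1
    rw [e, t2, hd] at b2
    ext <;> linarith
  have hFn : Fr L κ n = stdI := by
    obtain ⟨i1, i2⟩ := hT n le_rfl
    rw [ZMod.natCast_self] at i1 i2
    refine Prod.ext (hinj _ _ ?_) (hinj _ _ ?_)
    · rw [i1]; simp [stdI, colMap_apply]
    · rw [i2]; simp [stdI, colMap_apply]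
  refine ⟨hFn, ?_⟩
  have hht : ∀ j : ℕ, j ≤ n → vdet (A (-1) - A 0) (A (j : ZMod n) - A ((j : ZMod n) - 1)) =
      p 0 * p (j : ZMod n) * (zt L κ j).2 := by
    intro j hj
    have e0 := hu 0
    rw [zero_sub] at e0
    have e1 : A (j : ZMod n) - A ((j : ZMod n) - 1) = - (p (j : ZMod n) • u (j : ZMod n)) := by
      rw [← hu]; abel
    rw [e0, e1, ← (hT j hj).1]
    have : vdet (p 0 • u 0) (-(p (j : ZMod n) • colMap (u 0) (h 0) (Fr L κ j).1)) =
        vdet (u 0) (h 0) * (p 0 * p (j : ZMod n) * (-(Fr L κ j).1.2)) := by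
      simp [vdet, colMap_apply]; ring
    rw [this, hd, one_mul]; simp [zt]
  have hU0 : UH (zt L κ 0) := by rw [zt_zero]; right; simp
  have hpp : ∀ j : ℕ, 0 < p 0 * p (j : ZMod n) := fun j => mul_pos (hp _) (hp _)
  have hstep : ∀ j : ℕ, 0 < j → j + 1 < n → (zt L κ j).2 ≤ 0 → (zt L κ (j + 1)).2 < 0 := by
    intro j hj0 hj1 hz
    have := heights hA (i := (j : ZMod n)) (hcast j hj0 (by omega))
      (by have := hcast (j + 1) (by omega) hj1; push_cast at this; exact this) (hm1 _) (hm2 _)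
      (by rw [hht j (by omega)]; exact mul_nonpos_of_nonneg_of_nonpos (hpp j).le hz)
    have e := hht (j + 1) (by omega)
    push_cast at e
    rw [add_sub_cancel_right] at e
    rw [e] at this
    have h3 := hpp (j + 1)
    push_cast at h3
    by_contra hc
    push Not at hc
    have := mul_nonneg h3.le hc
    linarith
  have hcnt : ∀ j : ℕ, j < n → (UH (zt L κ j) ∧ cU (zt L κ) j = 0) ∨
      (¬ UH (zt L κ j) ∧ cU (zt L κ) j = 1) := by
    intro j
    induction j with
    | zero => intro _; left; exact ⟨hU0, rfl⟩
    | succ j ih =>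
      intro hj
      rcases ih (by omega) with ⟨a1, a2⟩ | ⟨a1, a2⟩
      · by_cases hu1 : UH (zt L κ (j + 1))
        · left; exact ⟨hu1, by simp [cU, a1, a2, hu1]⟩
        · right; exact ⟨hu1, by simp [cU, a1, a2, hu1]⟩
      · right
        have hj0 : 0 < j := by
          rcases Nat.eq_zero_or_pos j with rfl | h'
          · exact absurd hU0 a1
          · exact h'
        have hy : (zt L κ j).2 ≤ 0 := by
          by_contra hc
          exact a1 (Or.inl (by omega))
        have hy' := hstep j hj0 hj hy
        have hu1 : ¬ UH (zt L κ (j + 1)) := by rintro (h' | ⟨h', _⟩) <;> omega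
        exact ⟨hu1, by simp [cU, a1, a2, hu1]⟩
  obtain ⟨m, rfl⟩ : ∃ m, n = m + 1 := ⟨n - 1, by omega⟩
  have hUn : UH (zt L κ (m + 1)) := by
    right; simp [zt, hFn, stdI]
  have hpen : (zt L κ m).2 < 0 := by
    have e := hht m (by omega)
    have em : ((m : ℕ) : ZMod (m + 1)) = -1 := by
      have : ((m + 1 : ℕ) : ZMod (m + 1)) = 0 := ZMod.natCast_self _
      push_cast at this
      exact eq_neg_of_add_eq_zero_left this
    have hppm := hpp m
    rw [em] at e hppm
    have c := hA (-1) (-1 - 1) (hm1 _) (hm2 _)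
    rw [neg_add_cancel] at c
    have : vdet (A (-1) - A 0) (A (-1) - A (-1 - 1)) < 0 := by
      simp only [vdet, Prod.fst_sub, Prod.snd_sub] at c ⊢
      linarith
    rw [e] at this
    by_contra hc
    push Not at hc
    have := mul_nonneg hppm.le hc
    linarith
  have hUm : ¬ UH (zt L κ m) := by rintro (h' | ⟨h', _⟩) <;> omega
  rcases hcnt m (by omega) with ⟨a1, _⟩ | ⟨_, a2⟩
  · exact absurd a1 hUm
  · simp [cU, a2, hUm, hUn]

/-- **Theorem (solution of the IKEA problem).**
For `n ≥ 3`, rational integer angles `α₁,…,αₙ` (given by their LLS sequences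
`L 0, …, L (n-1)`) and integers `κ 0, …, κ (n-1)`, there exists a convex `n`-gon
with angle-curvature sequence `S = (α₁,κ₁,…,αₙ,κₙ)` if and only if
(1) `K(lls(S₁ⁿ)) = 0`,
(2) `κₙ = −⌊K(lls(S₂ⁿ)∘(1)) / K(lls(S₂ⁿ))⌋`, and
(3) the sequence `(K(lls(S₁ʲ)))_{j=1}^{n}` changes sign exactly `n−3` times. -/
theorem ikea_solution (n : ℕ) (hn : 3 ≤ n) (L : ℕ → List ℤ) (κ : ℕ → ℤ)
    (hL : ∀ i < n, ValidLLS (L i)) :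
    (∃ A : ZMod n → Pt, ConvexPolygon n A ∧ HasACS n A L κ) ↔
      (cont (llsCat L κ 0 (n - 1)) = 0 ∧
       κ (n - 1) =
         -⌊(cont (llsCat L κ 1 (n - 2) ++ [1]) : ℚ) / (cont (llsCat L κ 1 (n - 2)) : ℚ)⌋ ∧
       signChanges ((List.range n).map fun j => cont (llsCat L κ 0 j)) = n - 3) := by

  have hdet : ∀ j < n, vdet (zt L κ j) (zt L κ (j + 1)) < 0 := fun j hj =>
    zt_det L κ j (fun i hi => hL i (by omega))
  have hsc := sign_count (zt L κ) n (by omega) (zt_zero L κ) hdet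
  rw [cond_eq, cont_llsCat, Nat.sub_add_cancel (by omega)]
  obtain ⟨m, rfl⟩ : ∃ m, n = m + 2 := ⟨n - 2, by omega⟩
  have hfl := floor_cond L κ m hL
  rw [show m + 2 - 1 = m + 1 by omega, show m + 2 - 2 = m by omega]
  constructor
  · rintro ⟨A, hA, hS⟩
    obtain ⟨hF, hc⟩ := forward (m + 2) hn L κ hL A hA hS
    have hz : zt L κ (m + 2) = (-1, 0) := by simp [zt, hF, stdI]
    refine ⟨by rw [hz]; simp, (hfl hz).mpr hF, ?_⟩
    omega
  · rintro ⟨h1, h2, h3⟩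
    have hy : (zt L κ (m + 2)).2 = 0 := by
      rcases mul_eq_zero.mp h1 with h | h
      · exact absurd h (by simp)
      · exact h
    have hT := oneTurn_of_cU (zt L κ) (m + 2) (by omega) (zt_zero L κ) hdet hy
      (zt_prim L κ _ hL hy) (by omega)
    exact backward (m + 2) hn L κ hL hT ((hfl hT.last).mp h2)
end

section
/- Two triangles △ABC and △A'B'C' with integer vertices are integer congruent by a transformation sending A to A', B to B', C to C' if and only if the following integer angle-side-curvature-angle (ASCA) conditions hold: ∠ABC is integer congruent to ∠A'B'C', ∠BAC is integer congruent to ∠B'A'C', il(AB) = il(A'B'), and κ(CABC) = κ(C'A'B'C'). -/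
open scoped BigOperators

def IntAff.inv (T : IntAff) : IntAff where
  a := (T.a * T.d - T.b * T.c) * T.d
  b := -(T.a * T.d - T.b * T.c) * T.b
  c := -(T.a * T.d - T.b * T.c) * T.c
  d := (T.a * T.d - T.b * T.c) * T.a
  u := -((T.a * T.d - T.b * T.c) * (T.d * T.u - T.b * T.v))
  v := -((T.a * T.d - T.b * T.c) * (T.a * T.v - T.c * T.u))
  unimod := by
    rcases T.unimod with h | h <;> rw [h]
    · left; linarith
    · right; linarith

def IntAff.comp (S T : IntAff) : IntAff where
  a := S.a * T.a + S.b * T.c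
  b := S.a * T.b + S.b * T.d
  c := S.c * T.a + S.d * T.c
  d := S.c * T.b + S.d * T.d
  u := S.a * T.u + S.b * T.v + S.u
  v := S.c * T.u + S.d * T.v + S.v
  unimod := by
    have e : (S.a * T.a + S.b * T.c) * (S.c * T.b + S.d * T.d)
      - (S.a * T.b + S.b * T.d) * (S.c * T.a + S.d * T.c)
      = (S.a * S.d - S.b * S.c) * (T.a * T.d - T.b * T.c) := by ring
    rw [e]
    rcases T.unimod with h | h <;> rcases S.unimod with h' | h' <;> rw [h, h'] <;> simp

theorem comp_apply (S T : IntAff) (P : Pt) : (S.comp T).apply P = S.apply (T.apply P) := by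
  ext <;> simp only [IntAff.apply, IntAff.comp] <;> ring

theorem inv_app (T : IntAff) (P : Pt) : T.inv.apply (T.apply P) = P := by
  have h2 : (T.a * T.d - T.b * T.c) * (T.a * T.d - T.b * T.c) = 1 := by
    rcases T.unimod with h | h <;> rw [h] <;> simp
  ext <;> simp only [IntAff.apply, IntAff.inv]
  · linear_combination P.1 * h2
  · linear_combination P.2 * h2

theorem apply_inv (T : IntAff) (P : Pt) : T.apply (T.inv.apply P) = P := by
  have h2 : (T.a * T.d - T.b * T.c) * (T.a * T.d - T.b * T.c) = 1 := by
    rcases T.unimod with h | h <;> rw [h] <;> simp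
  ext <;> simp only [IntAff.apply, IntAff.inv]
  · linear_combination (P.1 - T.u) * h2
  · linear_combination (P.2 - T.v) * h2

/-- linear part -/
def IntAff.lin (T : IntAff) (w : Pt) : Pt := (T.a * w.1 + T.b * w.2, T.c * w.1 + T.d * w.2)

theorem lin_sub (T : IntAff) (P Q : Pt) : T.apply P - T.apply Q = T.lin (P - Q) := by
  ext <;> simp only [IntAff.apply, IntAff.lin, Prod.fst_sub, Prod.snd_sub] <;> ring

theorem lin_smul (T : IntAff) (s : ℤ) (P : Pt) : s • T.lin P = T.lin (s • P) := by
  ext <;> simp only [IntAff.lin, Prod.smul_fst, Prod.smul_snd, smul_eq_mul] <;> ring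

theorem lin_add (T : IntAff) (P Q : Pt) : T.lin P + T.lin Q = T.lin (P + Q) := by
  ext <;> simp only [IntAff.lin, Prod.fst_add, Prod.snd_add] <;> ring

theorem lin_inj (T : IntAff) (P Q : Pt) : T.lin P = T.lin Q ↔ P = Q := by
  refine ⟨fun h => ?_, fun h => h ▸ rfl⟩
  have h2 : (T.a * T.d - T.b * T.c) * (T.a * T.d - T.b * T.c) = 1 := by
    rcases T.unimod with h | h <;> rw [h] <;> simp
  have e1 := congrArg Prod.fst h
  have e2 := congrArg Prod.snd h
  simp only [IntAff.lin] at e1 e2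
  ext
  · linear_combination (T.a * T.d - T.b * T.c) * (T.d * e1 - T.b * e2) - (P.1 - Q.1) * h2
  · linear_combination (T.a * T.d - T.b * T.c) * (T.a * e2 - T.c * e1) - (P.2 - Q.2) * h2

theorem vdet_lin (T : IntAff) (P Q : Pt) : |vdet (T.lin P) (T.lin Q)| = |vdet P Q| := by
  have : vdet (T.lin P) (T.lin Q) = (T.a * T.d - T.b * T.c) * vdet P Q := by
    simp only [vdet, IntAff.lin]; ring
  rw [this]
  rcases T.unimod with h | h <;> rw [h] <;> simp

theorem gcd_dvd_lin (T : IntAff) (w : Pt) :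
    Int.gcd w.1 w.2 ∣ Int.gcd (T.lin w).1 (T.lin w).2 := by
  have h1 : (Int.gcd w.1 w.2 : ℤ) ∣ w.1 := Int.gcd_dvd_left ..
  have h2 : (Int.gcd w.1 w.2 : ℤ) ∣ w.2 := Int.gcd_dvd_right ..
  exact Int.dvd_gcd (dvd_add (h1.mul_left _) (h2.mul_left _))
    (dvd_add (h1.mul_left _) (h2.mul_left _))

theorem il_eq (P Q : Pt) : il P Q = (Int.gcd (Q - P).1 (Q - P).2 : ℕ) := rfl

theorem il_apply (T : IntAff) (P Q : Pt) : il (T.apply P) (T.apply Q) = il P Q := by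
  have key : ∀ (T : IntAff) (P Q : Pt), Int.gcd (Q - P).1 (Q - P).2 ∣
      Int.gcd (T.apply Q - T.apply P).1 (T.apply Q - T.apply P).2 := by
    intro T P Q
    rw [lin_sub]; exact gcd_dvd_lin T _
  rw [il_eq, il_eq]
  congr 1
  apply Nat.dvd_antisymm
  · have := key T.inv (T.apply P) (T.apply Q)
    rwa [inv_app, inv_app] at this
  · exact key T P Q

theorem idist_apply (T : IntAff) (P Q R : Pt) :
    idist (T.apply P) (T.apply Q) (T.apply R) = idist P Q R := by
  simp only [idist, il_apply, lin_sub, vdet_lin]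

theorem inAngle_apply (T : IntAff) (X V Y P : Pt) :
    InAngle (T.apply X) (T.apply V) (T.apply Y) (T.apply P) ↔ InAngle X V Y P := by
  simp only [InAngle, lin_sub, lin_smul, lin_add, lin_inj]

theorem onRay_apply (T : IntAff) (X V Y : Pt) :
    OnRay (T.apply X) (T.apply V) (T.apply Y) ↔ OnRay X V Y := by
  simp only [OnRay, lin_sub, lin_smul, lin_inj]

theorem isNearPt_apply (T : IntAff) (X V Y P : Pt) :
    IsNearPt (T.apply X) (T.apply V) (T.apply Y) (T.apply P) ↔ IsNearPt X V Y P := by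
  unfold IsNearPt
  rw [inAngle_apply, idist_apply, idist_apply]
  refine and_congr_right fun _ => and_congr_right fun _ => ⟨fun h Q => ?_, fun h Q => ?_⟩
  · have := h (T.apply Q)
    rwa [inAngle_apply, idist_apply, idist_apply] at this
  · have := h (T.inv.apply Q)
    rw [← inAngle_apply T, ← idist_apply T, ← idist_apply T (T.inv.apply Q) X V] at this
    rwa [apply_inv] at this

theorem sgnDir_lin (T : IntAff) (u w : Pt) : sgnDir (T.lin u) (T.lin w) = sgnDir u w := by
  have h0 : ((0 : ℤ), (0 : ℤ)) = T.lin ((0 : ℤ), (0 : ℤ)) := by simp [IntAff.lin]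
  have h1 : (T.lin w = ((0 : ℤ), (0 : ℤ))) ↔ (w = ((0 : ℤ), (0 : ℤ))) := by
    rw [h0, lin_inj, ← h0]
  have h2 : (∃ s t : ℤ, 0 < s ∧ 0 < t ∧ s • T.lin w = t • T.lin u) ↔
      ∃ s t : ℤ, 0 < s ∧ 0 < t ∧ s • w = t • u := by
    simp only [lin_smul, lin_inj]
  unfold sgnDir
  by_cases c1 : w = ((0 : ℤ), (0 : ℤ))
  · rw [if_pos c1, if_pos (h1.2 c1)]
  · rw [if_neg c1, if_neg (fun h => c1 (h1.1 h))]
    by_cases c2 : ∃ s t : ℤ, 0 < s ∧ 0 < t ∧ s • w = t • u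
    · rw [if_pos c2, if_pos (h2.2 c2)]
    · rw [if_neg c2, if_neg (fun h => c2 (h2.1 h))]

theorem chord_apply (T : IntAff) (A B C D : Pt) (k : ℤ) (h : IsChordCurv A B C D k) :
    IsChordCurv (T.apply A) (T.apply B) (T.apply C) (T.apply D) k := by
  obtain ⟨P, Q, hP, hQ, hk⟩ := h
  refine ⟨T.apply P, T.apply Q, (isNearPt_apply ..).2 hP, (isNearPt_apply ..).2 hQ, ?_⟩
  rw [il_apply, il_apply, lin_sub, lin_sub, sgnDir_lin, hk]

theorem angle_conj (S S' : IntAff) (X V Y X' V' Y' : Pt) (h : AngleCong X V Y X' V' Y') :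
    AngleCong (S.apply X) (S.apply V) (S.apply Y) (S'.apply X') (S'.apply V') (S'.apply Y') := by
  obtain ⟨T, h1, h2, h3⟩ := h
  refine ⟨S'.comp (T.comp S.inv), ?_, ?_, ?_⟩
  · simp only [comp_apply, inv_app, h1]
  · simp only [comp_apply, inv_app, onRay_apply, h2]
  · simp only [comp_apply, inv_app, onRay_apply, h3]

theorem normal_form (A B C : Pt) (h : vdet (B - A) (C - A) ≠ 0) :
    ∃ (S : IntAff) (n x y : ℤ), 0 < n ∧ 0 < y ∧ S.apply A = (0, 0) ∧ S.apply B = (n, 0) ∧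
      S.apply C = (x, y) := by
  obtain ⟨A1, A2⟩ := A
  obtain ⟨B1, B2⟩ := B
  obtain ⟨C1, C2⟩ := C
  simp only [vdet, Prod.mk_sub_mk] at h
  have hg := Int.gcd_eq_gcd_ab (B1 - A1) (B2 - A2)
  obtain ⟨p, hp⟩ : (Int.gcd (B1 - A1) (B2 - A2) : ℤ) ∣ B1 - A1 := Int.gcd_dvd_left ..
  obtain ⟨q, hq⟩ : (Int.gcd (B1 - A1) (B2 - A2) : ℤ) ∣ B2 - A2 := Int.gcd_dvd_right ..
  generalize Int.gcdA (B1 - A1) (B2 - A2) = r at *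
  generalize Int.gcdB (B1 - A1) (B2 - A2) = s at *
  have hg0 : (0 : ℤ) ≤ (Int.gcd (B1 - A1) (B2 - A2) : ℤ) := by positivity
  generalize (Int.gcd (B1 - A1) (B2 - A2) : ℤ) = g at *
  have hgne : g ≠ 0 := by
    rintro rfl
    apply h; rw [hp, hq]; ring
  have hpos : 0 < g := lt_of_le_of_ne hg0 (Ne.symm hgne)
  have hdet : p * r + q * s = 1 := by
    apply mul_left_cancel₀ hgne
    rw [hp, hq] at hg
    linarith
  rw [hp, hq] at h
  have hy : p * (C2 - A2) - q * (C1 - A1) ≠ 0 := by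
    intro h0; apply h; linear_combination g * h0
  rcases lt_or_gt_of_ne hy with hy | hy
  · refine ⟨⟨r, s, q, -p, -(r * A1 + s * A2), -(q * A1 - p * A2), Or.inr (by linarith)⟩, g,
      r * (C1 - A1) + s * (C2 - A2), -(p * (C2 - A2) - q * (C1 - A1)), hpos, by linarith,
      ?_, ?_, ?_⟩ <;> ext <;> simp only [IntAff.apply]
    · ring
    · ring
    · linear_combination r * hp + s * hq + g * hdet
    · linear_combination q * hp - p * hq
    · ring
    · ring
  · refine ⟨⟨r, s, -q, p, -(r * A1 + s * A2), (q * A1 - p * A2), Or.inl (by linarith)⟩, g,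
      r * (C1 - A1) + s * (C2 - A2), (p * (C2 - A2) - q * (C1 - A1)), hpos, by linarith,
      ?_, ?_, ?_⟩ <;> ext <;> simp only [IntAff.apply]
    · ring
    · ring
    · linear_combination r * hp + s * hq + g * hdet
    · linear_combination p * hq - q * hp
    · ring
    · ring

theorem inAngle_std (n x y p q : ℤ) (hn : 0 < n) (hy : 0 < y) :
    InAngle (x, y) (0, 0) (n, 0) (p, q) ↔ 0 ≤ q ∧ x * q ≤ p * y := by
  constructor
  · rintro ⟨Q, s, t, hQ, hs, ht, h⟩
    have e1 := congrArg Prod.fst h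
    have e2 := congrArg Prod.snd h
    simp at e1 e2
    constructor
    · by_contra hq
      push Not at hq
      nlinarith [mul_pos_of_neg_of_neg (neg_lt_zero.2 hQ) hq, mul_nonneg hs hy.le]
    · have : Q * (p * y - x * q) = t * n * y := by linear_combination y * e1 - x * e2
      have h3 : 0 ≤ Q * (p * y - x * q) := by rw [this]; positivity
      have := nonneg_of_mul_nonneg_right h3 hQ
      linarith
  · rintro ⟨h1, h2⟩
    refine ⟨n * y, n * q, p * y - x * q, by positivity, by positivity, by linarith, ?_⟩
    ext <;> simp <;> ring

theorem idist_base (n p q : ℤ) (hn : 0 < n) : idist (p, q) (0, 0) (n, 0) = |q| := by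
  have : il (0, 0) (n, 0) = n := by simp [il, abs_of_pos hn]
  rw [idist, this]
  simp only [vdet, Prod.mk_sub_mk]
  rw [show (n - 0) * (q - 0) - (0 - 0) * (p - 0) = n * q by ring, abs_mul, abs_of_pos hn]
  exact Int.mul_ediv_cancel_left _ hn.ne'

theorem idist_side (x y p q : ℤ) :
    idist (p, q) (x, y) (0, 0) = |y * p - x * q| / (Int.gcd x y : ℤ) := by
  have : il (x, y) (0, 0) = Int.gcd x y := by simp [il]
  rw [idist, this]
  simp only [vdet, Prod.mk_sub_mk]
  congr 2; ring

theorem near_std (n x y i : ℤ) (hn : 0 < n) (hy : 0 < y) (h1 : x ≤ i * y) (h2 : (i - 1) * y < x)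
    (P : Pt) : IsNearPt (x, y) (0, 0) (n, 0) P ↔ P = (i, 1) := by
  have hg : (0 : ℤ) < (Int.gcd x y : ℤ) := by
    exact_mod_cast Int.gcd_pos_of_ne_zero_right x hy.ne'
  have hge : ∀ p : ℤ, x * 1 ≤ p * y → i ≤ p := by
    intro p hp
    by_contra hc
    push Not at hc
    nlinarith [mul_nonneg (show 0 ≤ i - 1 - p by linarith) hy.le]
  have aux : ∀ q : ℤ, 0 ≤ q → |q| = 1 → q = 1 := by
    intro q hq h; rwa [abs_of_nonneg hq] at h
  constructor
  · obtain ⟨p, q⟩ := P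
    rintro ⟨ha, hb, hc⟩
    rw [inAngle_std _ _ _ _ _ hn hy] at ha
    rw [idist_base _ _ _ hn] at hb
    obtain rfl := aux q ha.1 hb
    have hip := hge p ha.2
    have := hc (i, 1) ((inAngle_std _ _ _ _ _ hn hy).2 ⟨by norm_num, by linarith⟩)
      (by rw [idist_base _ _ _ hn]; simp)
    rw [idist_side, idist_side, abs_of_nonneg (by linarith [ha.2]), abs_of_nonneg (by linarith)]
      at this
    have hdv : ∀ p : ℤ, (Int.gcd x y : ℤ) ∣ y * p - x * 1 := fun p =>
      dvd_sub ((Int.gcd_dvd_right ..).mul_right _) ((Int.gcd_dvd_left ..).mul_right _)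
    have h3 : y * p - x * 1 ≤ y * i - x * 1 := by
      have := mul_le_mul_of_nonneg_right this hg.le
      rwa [Int.ediv_mul_cancel (hdv p), Int.ediv_mul_cancel (hdv i)] at this
    have h4 : p ≤ i := le_of_mul_le_mul_left (by linarith) hy
    rw [le_antisymm h4 hip]
  · rintro rfl
    refine ⟨(inAngle_std _ _ _ _ _ hn hy).2 ⟨by norm_num, by linarith⟩,
      by rw [idist_base _ _ _ hn]; simp, ?_⟩
    rintro ⟨p, q⟩ ha hb
    rw [inAngle_std _ _ _ _ _ hn hy] at ha
    rw [idist_base _ _ _ hn] at hb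
    obtain rfl := aux q ha.1 hb
    have hip := hge p ha.2
    rw [idist_side, idist_side, abs_of_nonneg (by linarith [ha.2]), abs_of_nonneg (by linarith)]
    apply Int.ediv_le_ediv hg
    nlinarith

theorem near_std' (n x y j : ℤ) (hn : 0 < n) (hy : 0 < y) (h1 : n - x ≤ j * y)
    (h2 : (j - 1) * y < n - x) (P : Pt) :
    IsNearPt (x, y) (n, 0) (0, 0) P ↔ P = (n - j, 1) := by
  let R : IntAff := ⟨-1, 0, 0, 1, n, 0, by norm_num⟩
  have hR : ∀ p q : ℤ, R.apply (p, q) = (n - p, q) := by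
    intro p q; simp only [R, IntAff.apply]; ext <;> ring_nf
  obtain ⟨p, q⟩ := P
  rw [← isNearPt_apply R, hR, hR, hR, hR, sub_self, sub_zero, near_std n (n - x) y j hn hy h1 h2]
  simp only [Prod.mk.injEq]
  constructor <;> rintro ⟨h, h'⟩ <;> exact ⟨by linarith, h'⟩

theorem sgn_il_s3 (n i j : ℤ) (hn : 0 < n) :
    sgnDir ((n, 0) - (0, 0)) ((j, 1) - (i, 1)) * il (i, 1) (j, 1) = j - i := by
  have hil : il (i, 1) (j, 1) = |j - i| := by simp [il]
  rw [hil]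
  unfold sgnDir
  split_ifs with h1 h2
  · simp at h1; rw [h1]; simp
  · obtain ⟨s, t, hs, ht, h⟩ := h2
    have e1 := congrArg Prod.fst h
    simp at e1
    have : 0 < s * (j - i) := by rw [e1]; positivity
    rw [abs_of_pos (pos_of_mul_pos_right this hs.le)]; ring
  · have : j - i ≤ 0 := by
      by_contra hc
      push Not at hc
      exact h2 ⟨n, j - i, hn, hc, by ext <;> simp; ring⟩
    rw [abs_of_nonpos this]; ring

theorem chord_std (n x y i j k : ℤ) (hn : 0 < n) (hy : 0 < y) (h1 : x ≤ i * y)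
    (h2 : (i - 1) * y < x) (h3 : n - x ≤ j * y) (h4 : (j - 1) * y < n - x) :
    IsChordCurv (x, y) (0, 0) (n, 0) (x, y) k ↔ k = i + j - 2 := by
  have hil : il (0, 0) (n, 0) = n := by simp [il, abs_of_pos hn]
  unfold IsChordCurv
  simp only [near_std n x y i hn hy h1 h2, near_std' n x y j hn hy h3 h4]
  constructor
  · rintro ⟨P, Q, rfl, rfl, rfl⟩
    rw [sgn_il_s3 _ _ _ hn, hil]; ring
  · rintro rfl
    refine ⟨_, _, rfl, rfl, ?_⟩
    rw [sgn_il_s3 _ _ _ hn, hil]; ring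

theorem ceil_ex (x y : ℤ) (hy : 0 < y) : ∃ i : ℤ, x ≤ i * y ∧ (i - 1) * y < x := by
  refine ⟨-((-x) / y), ?_, ?_⟩
  · have := Int.ediv_mul_le (-x) hy.ne'; linarith
  · have := Int.lt_ediv_add_one_mul_self (-x) hy; linarith

theorem ceil_uniq (x y x' y' i i' b : ℤ) (hy : 0 < y) (hy' : 0 < y')
    (h : (x + b * y) * y' = x' * y) (h1 : x ≤ i * y) (h2 : (i - 1) * y < x)
    (h1' : x' ≤ i' * y') (h2' : (i' - 1) * y' < x') : i' = i + b := by
  have hp : 0 < y * y' := mul_pos hy hy'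
  have a1 : x * y' ≤ i * y * y' := mul_le_mul_of_nonneg_right h1 hy'.le
  have a2 : (i - 1) * y * y' < x * y' := mul_lt_mul_of_pos_right h2 hy'
  have a3 : x' * y ≤ i' * y' * y := mul_le_mul_of_nonneg_right h1' hy.le
  have a4 : (i' - 1) * y' * y < x' * y := mul_lt_mul_of_pos_right h2' hy
  have l1 : i' - 1 < i + b := by
    apply lt_of_mul_lt_mul_right _ hp.le
    nlinarith
  have l2 : i + b < i' + 1 := by
    apply lt_of_mul_lt_mul_right _ hp.le
    nlinarith
  omega

/-- angles in normal form -/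
theorem angle_std (n x y n' x' y' : ℤ) (hn : 0 < n) (hn' : 0 < n') (hy : 0 < y) (hy' : 0 < y')
    (h : AngleCong (n, 0) (0, 0) (x, y) (n', 0) (0, 0) (x', y')) :
    ∃ b : ℤ, (x + b * y) * y' = x' * y := by
  obtain ⟨⟨a, b, c, d, u, v, hdet⟩, h0, ⟨s, t, hs, ht, h1⟩, ⟨s', t', hs', ht', h2⟩⟩ := h
  simp [IntAff.apply] at h0 h1 h2
  obtain ⟨rfl, rfl⟩ := h0
  simp at h1 h2
  obtain ⟨e1, e2⟩ := h1
  obtain ⟨f1, f2⟩ := h2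
  have hc : c = 0 := by
    rcases e2 with h | h | h
    · omega
    · exact h
    · omega
  subst hc
  have ha : 0 < a := by
    have : 0 < s * (a * n) := by rw [e1]; positivity
    exact pos_of_mul_pos_left (pos_of_mul_pos_right this hs.le) hn.le
  have hd : 0 < d := by
    have : 0 < s' * (0 * x + d * y) := by
      rw [f2]; positivity
    have := pos_of_mul_pos_right this hs'.le
    rw [zero_mul, zero_add] at this
    exact pos_of_mul_pos_left this hy.le
  have had : a * d = 1 := by
    rcases hdet with h | h
    · linarith
    · nlinarith [mul_pos ha hd]
  have ha1 : a = 1 := by nlinarith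
  subst ha1
  have hd1 : d = 1 := by linarith
  subst hd1
  refine ⟨b, ?_⟩
  apply mul_left_cancel₀ (mul_pos hs' ht').ne'
  have g2 : s' * y = t' * y' := by simpa using f2
  linear_combination t' * y' * f1 - t' * x' * g2

theorem core (n x y x' y' k : ℤ) (hn : 0 < n) (hy : 0 < y) (hy' : 0 < y')
    (hA : AngleCong (n, 0) (0, 0) (x, y) (n, 0) (0, 0) (x', y'))
    (hB : AngleCong (0, 0) (n, 0) (x, y) (0, 0) (n, 0) (x', y'))
    (hk : IsChordCurv (x, y) (0, 0) (n, 0) (x, y) k)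
    (hk' : IsChordCurv (x', y') (0, 0) (n, 0) (x', y') k) :
    ∃ b : ℤ, x' = x + b * y ∧ y' = y := by
  let R : IntAff := ⟨-1, 0, 0, 1, n, 0, by norm_num⟩
  have hR : ∀ p q : ℤ, R.apply (p, q) = (n - p, q) := by
    intro p q; simp only [R, IntAff.apply]; ext <;> ring_nf
  have hB2 := angle_conj R R _ _ _ _ _ _ hB
  simp only [hR, sub_self, sub_zero] at hB2
  obtain ⟨b, hb⟩ := angle_std _ _ _ _ _ _ hn hn hy hy' hA
  obtain ⟨c, hc⟩ := angle_std _ _ _ _ _ _ hn hn hy hy' hB2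
  obtain ⟨i, i1, i2⟩ := ceil_ex x y hy
  obtain ⟨j, j1, j2⟩ := ceil_ex (n - x) y hy
  obtain ⟨i', i1', i2'⟩ := ceil_ex x' y' hy'
  obtain ⟨j', j1', j2'⟩ := ceil_ex (n - x') y' hy'
  rw [chord_std n x y i j k hn hy i1 i2 j1 j2] at hk
  rw [chord_std n x' y' i' j' k hn hy' i1' i2' j1' j2'] at hk'
  have u1 := ceil_uniq _ _ _ _ _ _ _ hy hy' hb i1 i2 i1' i2'
  have u2 := ceil_uniq _ _ _ _ _ _ _ hy hy' hc j1 j2 j1' j2'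
  have hcb : c = -b := by linarith
  subst hcb
  have hyy : y' = y := by
    apply mul_left_cancel₀ hn.ne'
    linear_combination hb + hc
  subst hyy
  exact ⟨b, mul_right_cancel₀ hy.ne' hb.symm, rfl⟩

theorem onRay_self (V X : Pt) : OnRay V X X := ⟨1, 1, one_pos, one_pos, rfl⟩

/-- **Proposition (ASCA rule).** Two triangles `△ABC` and `△A'B'C'` with integer
vertices are integer congruent (by a transformation sending `A ↦ A'`, `B ↦ B'`,
`C ↦ C'`) if and only if `∠ABC ≅ ∠A'B'C'`, `∠BAC ≅ ∠B'A'C'`, `il(AB) = il(A'B')`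
and `κ(CABC) = κ(C'A'B'C')`. -/
theorem asca_rule (A B C A' B' C' : Pt)
    (hABC : vdet (B - A) (C - A) ≠ 0) (hABC' : vdet (B' - A') (C' - A') ≠ 0) :
    (∃ T : IntAff, T.apply A = A' ∧ T.apply B = B' ∧ T.apply C = C') ↔
      (AngleCong A B C A' B' C' ∧ AngleCong B A C B' A' C' ∧
       il A B = il A' B' ∧
       ∃ k : ℤ, IsChordCurv C A B C k ∧ IsChordCurv C' A' B' C' k) := by
  obtain ⟨S, n, x, y, hn, hy, hSA, hSB, hSC⟩ := normal_form A B C hABC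
  constructor
  · rintro ⟨T, rfl, rfl, rfl⟩
    refine ⟨⟨T, rfl, onRay_self _ _, onRay_self _ _⟩, ⟨T, rfl, onRay_self _ _, onRay_self _ _⟩,
      (il_apply _ _ _).symm, ?_⟩
    obtain ⟨i, i1, i2⟩ := ceil_ex x y hy
    obtain ⟨j, j1, j2⟩ := ceil_ex (n - x) y hy
    have h := (chord_std n x y i j _ hn hy i1 i2 j1 j2).2 rfl
    rw [← hSA, ← hSB, ← hSC] at h
    have h' := chord_apply S.inv _ _ _ _ _ h
    simp only [inv_app] at h'
    exact ⟨_, h', chord_apply T _ _ _ _ _ h'⟩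
  · rintro ⟨hB, hA, hil, k, hk, hk'⟩
    obtain ⟨S', n', x', y', hn', hy', hSA', hSB', hSC'⟩ := normal_form A' B' C' hABC'
    have hB2 := angle_conj S S' _ _ _ _ _ _ hB
    have hA2 := angle_conj S S' _ _ _ _ _ _ hA
    have c1 := chord_apply S _ _ _ _ _ hk
    have c2 := chord_apply S' _ _ _ _ _ hk'
    rw [← il_apply S A B, ← il_apply S' A' B'] at hil
    rw [hSA, hSB, hSA', hSB'] at hil
    have hnn : n = n' := by simpa [il, abs_of_pos hn, abs_of_pos hn'] using hil
    subst hnn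
    rw [hSA, hSB, hSC, hSA', hSB', hSC'] at hA2 hB2
    rw [hSA, hSB, hSC] at c1
    rw [hSA', hSB', hSC'] at c2
    obtain ⟨b, e1, e2⟩ := core n x y x' y' k hn hy hy' hA2 hB2 c1 c2
    refine ⟨S'.inv.comp (IntAff.comp ⟨1, b, 0, 1, 0, 0, by norm_num⟩ S), ?_, ?_, ?_⟩
    · rw [comp_apply, comp_apply, hSA, ← inv_app S' A', hSA']; simp [IntAff.apply]
    · rw [comp_apply, comp_apply, hSB, ← inv_app S' B', hSB']; simp [IntAff.apply]
    · rw [comp_apply, comp_apply, hSC, ← inv_app S' C', hSC', e1, e2]; simp [IntAff.apply]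
end
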